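/- arXiv:2210.07989 — 2 statements merged into one kernel-verified Lean document; each statement's English description precedes it below -/
import Mathlib

section
/- Let R be a subring of ℚ with R ≠ ℤ. Then there exists a family (F_x), indexed by subsets x of ℕ, of R-submodules of ℝ such that: each F_x is uncountable and is a countable union of closed subsets of ℝ (in particular Borel); for all x, y ⊆ ℕ, if x \ y is finite then F_x ⊆ F_y; and for all x, y ⊆ ℕ, if x \ y is infinite then every Borel-measurable function f : F_x → F_y that is additive and satisfies f(r·m) = r·f(m) for all r ∈ R and m ∈ F_x is constantly equal to zero. -/
open Set Filter
open scoped ENNReal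

/-- `a₀ a₁ ⋯ a_{n-1}` as a real number: the product of the first `n` terms of the
base sequence (the paper's `a₁ ⋯ a_n`, re-indexed from 0). -/
noncomputable def bProd (a : ℕ → ℕ) (n : ℕ) : ℝ := ∏ k ∈ Finset.range n, (a k : ℝ)

/-- The `n`-th digit (0-indexed; the paper's `(n+1)`-st digit) of the nonnegative
real `r` in base `a`:  `r_n = ⌊a₁⋯a_n (r - ⌊r⌋)⌋ - a_n ⌊a₁⋯a_{n-1} (r - ⌊r⌋)⌋`. -/
noncomputable def digit (a : ℕ → ℕ) (r : ℝ) (n : ℕ) : ℤ :=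
  ⌊bProd a (n + 1) * Int.fract r⌋ - (a n : ℤ) * ⌊bProd a n * Int.fract r⌋

/-- `j_a(r) = { n : r_n ≠ r_{n+1} }`. -/
def jSet (a : ℕ → ℕ) (r : ℝ) : Set ℕ := {n | digit a r n ≠ digit a r (n + 1)}

/-- An ideal of subsets of ℕ: closed under subsets and finite unions, containing
all singletons (hence nonempty). -/
def IsIdeal (I : Set (Set ℕ)) : Prop :=
  (∀ ⦃x y : Set ℕ⦄, x ∈ I → y ⊆ x → y ∈ I) ∧
  (∀ ⦃x y : Set ℕ⦄, x ∈ I → y ∈ I → x ∪ y ∈ I) ∧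
  (∀ n : ℕ, ({n} : Set ℕ) ∈ I)

/-- Translation invariance of a family of subsets of ℕ. -/
def TransInv (I : Set (Set ℕ)) : Prop :=
  ∀ x ∈ I, ({n | ∃ m ∈ x, n = m + 1} ∈ I) ∧ ({n | n + 1 ∈ x} ∈ I)

/-- A tall family: every infinite set of naturals has an infinite subset in the family. -/
def TallIdeal (I : Set (Set ℕ)) : Prop :=
  ∀ x : Set ℕ, x.Infinite → ∃ y, y ⊆ x ∧ y.Infinite ∧ y ∈ I

/-- The base sequence `a` is adapted to `I` if `{n : a_n ≠ a_{n+1}} ∈ I`. -/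
def AdaptedTo (a : ℕ → ℕ) (I : Set (Set ℕ)) : Prop := {n | a n ≠ a (n + 1)} ∈ I

/-- A lower semicontinuous submeasure on subsets of ℕ. -/
def IsLscSubmeasure (φ : Set ℕ → ℝ≥0∞) : Prop :=
  φ ∅ = 0 ∧
  (∀ ⦃x y : Set ℕ⦄, x ⊆ y → φ x ≤ φ y) ∧
  (∀ x y : Set ℕ, φ (x ∪ y) ≤ φ x + φ y) ∧
  (∀ n : ℕ, 0 < φ {n} ∧ φ {n} < ⊤) ∧
  (∀ x : Set ℕ, φ x = ⨆ n : ℕ, φ (x ∩ {k | k < n}))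

/-- `Exh(φ) = { x ⊆ ℕ : φ(x \ {0,…,n-1}) → 0 }`. -/
def Exh (φ : Set ℕ → ℝ≥0∞) : Set (Set ℕ) :=
  {x | Filter.Tendsto (fun n => φ (x \ {k | k < n})) Filter.atTop (nhds 0)}

/-- `pr(a)`: the set of primes dividing `a_n` for all but finitely many `n`. -/
def prSet (a : ℕ → ℕ) : Set ℕ := {p | p.Prime ∧ ∀ᶠ n in Filter.atTop, p ∣ a n}

/-- A base sequence is uniform if every prime dividing some `a_n` divides `a_n`
for all but finitely many `n`. -/
def UniformBase (a : ℕ → ℕ) : Prop :=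
  ∀ p : ℕ, p.Prime → (∃ n, p ∣ a n) → ∀ᶠ n in Filter.atTop, p ∣ a n

/-- `ℚ_a`, viewed as a set of real numbers: fractions `k/l` with every prime
divisor of `l` in `pr(a)`. -/
def Qa (a : ℕ → ℕ) : Set ℝ :=
  {r | ∃ (k : ℤ) (l : ℕ), 0 < l ∧ (∀ p : ℕ, p.Prime → p ∣ l → p ∈ prSet a) ∧
    r = (k : ℝ) / (l : ℝ)}

/-- `H = { r ∈ ℝ : j_a(|r|) ∈ I }`. -/
def Hset (a : ℕ → ℕ) (I : Set (Set ℕ)) : Set ℝ := {r | jSet a |r| ∈ I}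

/-- `ρ(r,s) = φ(j_a(|r-s|)) + |r-s|`. -/
noncomputable def rho (a : ℕ → ℕ) (φ : Set ℕ → ℝ≥0∞) (r s : ℝ) : ℝ :=
  (φ (jSet a |r - s|)).toReal + |r - s|

/-- The sum of the terms of `b` selected by `A`. -/
noncomputable def subsum (b : ℕ → ℝ) (A : ℕ → Bool) : ℝ := ∑' k, if A k then b k else 0

theorem summable_select {b : ℕ → ℝ} (hb : Summable b) (A : ℕ → Bool) :
    Summable fun k => if A k then b k else 0 := by
  refine Summable.of_norm_bounded hb.norm fun k => ?_
  split_ifs <;> simp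

theorem continuous_subsum {b : ℕ → ℝ} (hb : Summable b) : Continuous (subsum b) := by
  refine continuous_tsum (u := fun k => ‖b k‖) (fun k => ?_) hb.norm fun k A => ?_
  · exact (continuous_of_discreteTopology (f := fun c : Bool => if c then b k else 0)).comp
      (continuous_apply k)
  · split_ifs <;> simp

theorem subsum_add {b : ℕ → ℝ} (hb : Summable b) {A B C : ℕ → Bool}
    (hC : ∀ k, C k = (A k || B k)) (hAB : ∀ k, (A k && B k) = false) :
    subsum b C = subsum b A + subsum b B := by
  unfold subsum
  rw [← (summable_select hb A).tsum_add (summable_select hb B)]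
  refine tsum_congr fun k => ?_
  have h := hAB k
  rw [hC k]
  cases hA : A k <;> cases hB : B k <;> simp_all

theorem subsum_true (b : ℕ → ℝ) : subsum b (fun _ => true) = ∑' k, b k := by
  simp [subsum]

theorem subsum_single (b : ℕ → ℝ) (n : ℕ) : subsum b (fun k => decide (k = n)) = b n := by
  unfold subsum
  rw [tsum_eq_single n (by simp +contextual)]
  simp

theorem exists_cylinder_subset {U : Set (ℕ → Bool)} (hU : IsOpen U) {s : ℕ → Bool} (hs : s ∈ U) :
    ∃ K, ∀ A : ℕ → Bool, (∀ n < K, A n = s n) → A ∈ U := by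
  obtain ⟨_, ⟨y, K, rfl⟩, hy, hyU⟩ :=
    (PiNat.isTopologicalBasis_cylinders fun _ : ℕ => Bool).exists_subset_of_mem_open hs hU
  refine ⟨K, fun A hA => hyU ?_⟩
  rw [PiNat.mem_cylinder_iff] at hy ⊢
  exact fun i hi => (hA i hi).trans (hy i hi)

/-- If the subsums of `b` are covered by countably many closed sets, then one of these contains
pairs of points at difference `b k`, for all large `k`. -/
theorem exists_sub_eq_of_subsum_mem {ι : Type*} [Countable ι] {b : ℕ → ℝ} (hb : Summable b)
    {C : ι → Set ℝ} (hC : ∀ i, IsClosed (C i)) (hcov : ∀ A, ∃ i, subsum b A ∈ C i) :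
    ∃ i K, ∀ k ≥ K, ∃ u ∈ C i, ∃ v ∈ C i, u - v = b k := by
  obtain ⟨i, s, hs⟩ := nonempty_interior_of_iUnion_of_closed
    (f := fun i => subsum b ⁻¹' C i) (fun i => (hC i).preimage (continuous_subsum hb))
    (eq_univ_of_forall fun A => mem_iUnion.2 (hcov A))
  obtain ⟨K, hK⟩ := exists_cylinder_subset isOpen_interior hs
  have key : ∀ k ≥ K, ∀ c, subsum b (Function.update s k c) ∈ C i := fun k hk c =>
    (interior_subset : _ ⊆ subsum b ⁻¹' C i)
      (hK (Function.update s k c) fun n hn => Function.update_of_ne (by omega) _ _)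
  refine ⟨i, K, fun k hk => ⟨_, key k hk true, _, key k hk false, ?_⟩⟩
  rw [sub_eq_iff_eq_add, ← subsum_single b k]
  refine subsum_add hb (fun n => ?_) fun n => ?_ <;> by_cases h : n = k <;> simp [h]

/-- A Borel additive map vanishing on the terms of a series, all of whose subsums lie in its
domain, vanishes on the sum of the series. -/
theorem map_tsum_eq_zero {G : AddSubgroup ℝ} (g : G →+ ℝ) (hg : Measurable g) {b : ℕ → ℝ}
    (hb : Summable b) (hG : ∀ A, subsum b A ∈ G) (hbG : ∀ k, b k ∈ G)
    (h0 : ∀ k, g ⟨b k, hbG k⟩ = 0) : g ⟨subsum b fun _ => true, hG _⟩ = 0 := by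
  set h : (ℕ → Bool) → ℝ := fun A => g ⟨subsum b A, hG A⟩ with hh
  have hadd : ∀ {A B C : ℕ → Bool}, (∀ k, C k = (A k || B k)) →
      (∀ k, (A k && B k) = false) → h C = h A + h B := by
    intro A B C hC hAB
    simp only [hh]
    rw [← map_add]
    congr 1
    exact Subtype.ext (subsum_add hb hC hAB)
  have hfin : ∀ (K : ℕ) (A : ℕ → Bool), (∀ k, K ≤ k → A k = false) → h A = 0 := by
    intro K A hA
    have : (⟨subsum b A, hG A⟩ : G) =
        ∑ k ∈ Finset.range K, if A k then (⟨b k, hbG k⟩ : G) else 0 := by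
      apply Subtype.ext
      rw [AddSubgroup.val_finsetSum]
      simp only [subsum]
      rw [tsum_eq_sum (s := Finset.range K)]
      · exact Finset.sum_congr rfl fun k _ => by split_ifs <;> rfl
      · intro k hk
        simp [hA k (by simpa using hk)]
    simp only [hh]
    rw [this, map_sum]
    refine Finset.sum_eq_zero fun k _ => ?_
    split_ifs
    · exact h0 k
    · exact map_zero g
  have hmeas : Measurable h :=
    hg.comp (((continuous_subsum hb).subtype_mk hG).measurable)
  suffices ∀ ε > 0, |h fun _ => true| ≤ 5 * ε by
    rw [← abs_nonpos_iff]
    refine le_of_forall_pos_le_add fun ε hε => ?_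
    have := this (ε / 5) (by positivity)
    change |h fun _ => true| ≤ _
    linarith
  intro ε hε
  have hcov : ∃ j : ℤ, ¬ IsMeagre (h ⁻¹' Ico (j * ε) ((j + 1) * ε)) := by
    by_contra! hcon
    refine not_isMeagre_of_isOpen (X := ℕ → Bool) isOpen_univ univ_nonempty ?_
    refine (isMeagre_iUnion hcon).mono fun A _ => mem_iUnion.2 ⟨⌊h A / ε⌋, ?_⟩
    rw [mem_preimage, mem_Ico, ← le_div_iff₀ hε, ← div_lt_iff₀ hε]
    exact ⟨Int.floor_le _, Int.lt_floor_add_one _⟩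
  obtain ⟨j, hj⟩ := hcov
  obtain ⟨U, hU, hZU⟩ :=
    (hmeas (measurableSet_Ico (a := j * ε) (b := (j + 1) * ε))).residualEq_isOpen
  have hUne : U.Nonempty := by
    by_contra hcon
    rw [not_nonempty_iff_eq_empty] at hcon
    subst hcon
    refine hj ?_
    filter_upwards [eventuallyEq_set.1 hZU] with A hA
    exact fun h => (hA.1 h)
  obtain ⟨s, hs⟩ := hUne
  obtain ⟨K, hK⟩ := exists_cylinder_subset hU hs
  have key : ∀ J : Fin 3 → Bool, Function.Surjective J →
      ∀ᶠ t in residual (ℕ → Fin 3),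
        h (fun n => decide (K ≤ n) && J (t n)) ∈ Ico (j * ε) ((j + 1) * ε) := by
    intro J hJ
    let φ : ℕ → Fin 3 → Bool := fun n => if n < K then fun _ => s n else J
    have ht : Tendsto (Pi.map φ) (residual (ℕ → Fin 3)) (residual (ℕ → Bool)) := by
      refine tendsto_residual_of_isOpenMap ?_ (IsOpenMap.piMap ?_ ?_)
      · exact Continuous.piMap fun n => continuous_of_discreteTopology
      · exact fun n V _ => isOpen_discrete _
      · rw [Nat.cofinite_eq_atTop]
        filter_upwards [eventually_ge_atTop K] with n hn
        simpa [φ, not_lt.2 hn] using hJ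
    filter_upwards [ht.eventually (eventuallyEq_set.1 hZU)] with t ht
    have hmem : Pi.map φ t ∈ U := hK _ fun n hn => by simp [φ, hn]
    have := ht.2 hmem
    rw [mem_preimage, hadd (A := fun n => decide (K ≤ n) && J (t n))
      (B := fun n => decide (n < K) && s n), hfin K (fun n => decide (n < K) && s n),
      add_zero] at this
    · exact this
    · intro n hn
      simp [hn]
    · intro n
      by_cases hn : n < K
      · simp [φ, hn]
      · simp [φ, hn, not_lt.1 hn]
    · intro n
      by_cases hn : n < K <;> simp [hn]
  have key' := ((key (fun i => decide (i = 0)) (by decide)).and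
    (key (fun i => decide (i = 1)) (by decide))).and
    ((key (fun i => decide (i = 2)) (by decide)).and
    (key (fun i => decide (i ≠ 2)) (by decide)))
  obtain ⟨t, ⟨h1, h2⟩, h3, h4⟩ := (dense_of_mem_residual key').nonempty
  have fin3 : ∀ i : Fin 3, i = 0 ∨ i = 1 ∨ i = 2 := by decide
  rw [hadd (A := fun n => decide (K ≤ n) && decide (t n = 0))
    (B := fun n => decide (K ≤ n) && decide (t n = 1))
    (fun n => by by_cases hn : K ≤ n <;> rcases fin3 (t n) with h | h | h <;> simp [hn, h])
    (fun n => by by_cases hn : K ≤ n <;> rcases fin3 (t n) with h | h | h <;> simp [hn, h])] at h4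
  rw [hadd (A := fun n => decide (n < K)) (B := fun n => decide (K ≤ n))
    (fun n => by simp [lt_or_ge]) (fun n => by simp),
    hfin K _ (fun k hk => by simp [hk]), zero_add,
    hadd (A := fun n => decide (K ≤ n) && decide (t n ≠ 2))
    (B := fun n => decide (K ≤ n) && decide (t n = 2))
    (fun n => by by_cases hn : K ≤ n <;> rcases fin3 (t n) with h | h | h <;> simp [hn, h])
    (fun n => by by_cases hn : K ≤ n <;> rcases fin3 (t n) with h | h | h <;> simp [hn, h]),
    hadd (A := fun n => decide (K ≤ n) && decide (t n = 0))
    (B := fun n => decide (K ≤ n) && decide (t n = 1))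
    (fun n => by by_cases hn : K ≤ n <;> rcases fin3 (t n) with h | h | h <;> simp [hn, h])
    (fun n => by by_cases hn : K ≤ n <;> rcases fin3 (t n) with h | h | h <;> simp [hn, h])]
  simp only [mem_Ico] at h1 h2 h3 h4
  rw [abs_le]
  constructor <;> linarith

theorem Subring.inv_den_mem {R : Subring ℚ} {q : ℚ} (hq : q ∈ R) : (q.den : ℚ)⁻¹ ∈ R := by
  obtain ⟨u, v, huv⟩ := Rat.isCoprime_num_den q
  have hden : (q.den : ℚ) ≠ 0 := by exact_mod_cast q.den_nz
  have : (q.den : ℚ)⁻¹ = u * q + v := by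
    have h : (u * q.num + v * q.den : ℚ) = 1 := by exact_mod_cast huv
    have hn : (q.num : ℚ) = q * q.den := (Rat.mul_den_eq_num q).symm
    rw [hn] at h
    field_simp
    linarith
  rw [this]
  exact R.add_mem (R.mul_mem (intCast_mem R u) hq) (intCast_mem R v)

theorem Subring.exists_two_le_inv_mem {R : Subring ℚ}
    (hR : (R : Set ℚ) ≠ Set.range (Int.cast : ℤ → ℚ)) : ∃ d : ℕ, 2 ≤ d ∧ (d : ℚ)⁻¹ ∈ R := by
  have hsub : Set.range (Int.cast : ℤ → ℚ) ⊆ R := by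
    rintro _ ⟨z, rfl⟩
    exact intCast_mem R z
  obtain ⟨q, hq, hqz⟩ := not_subset.1 fun h => hR (h.antisymm hsub)
  refine ⟨q.den, ?_, inv_den_mem hq⟩
  by_contra! hlt
  have : q.den = 1 := by have := q.pos; omega
  exact hqz ⟨q.num, (Rat.den_eq_one_iff q).1 this⟩

theorem UnitAddCircle.norm_coe_le (u : ℝ) (z : ℤ) : ‖(u : UnitAddCircle)‖ ≤ |u - z| := by
  rw [UnitAddCircle.norm_eq]
  exact round_le u z

open Classical in
/-- The permitted order of magnitude of the distance of `d ^ k ^ 2 * r` to the integers. -/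
noncomputable def gapWeight (d : ℕ) (x : Set ℕ) (k : ℕ) : ℝ :=
  if k ∈ x then ((d : ℝ) ^ k)⁻¹ else ((d : ℝ) ^ (2 * k))⁻¹

/-- The permitted order of magnitude of the distance of `r` to the multiples of
`d⁻¹ ^ k ^ 2`. -/
noncomputable def gapError (d : ℕ) (x : Set ℕ) (k : ℕ) : ℝ :=
  gapWeight d x k / (d : ℝ) ^ k ^ 2

theorem exists_gapError_eq (d : ℕ) (x : Set ℕ) (k : ℕ) :
    ∃ e, k ^ 2 + k ≤ e ∧ e ≤ k ^ 2 + 2 * k ∧ gapError d x k = ((d : ℝ) ^ e)⁻¹ := by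
  unfold gapError gapWeight
  split_ifs
  · exact ⟨k ^ 2 + k, le_rfl, by omega, by rw [pow_add, mul_inv, div_eq_mul_inv, mul_comm]⟩
  · exact ⟨k ^ 2 + 2 * k, by omega, le_rfl, by rw [pow_add, mul_inv, div_eq_mul_inv, mul_comm]⟩

theorem gapWeight_pos {d : ℕ} (hd : 2 ≤ d) (x : Set ℕ) (k : ℕ) : 0 < gapWeight d x k := by
  have : (0 : ℝ) < d := by positivity
  unfold gapWeight
  split_ifs <;> positivity

theorem gapError_pos {d : ℕ} (hd : 2 ≤ d) (x : Set ℕ) (k : ℕ) : 0 < gapError d x k := by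
  have : (0 : ℝ) < d := by positivity
  exact div_pos (gapWeight_pos hd x k) (by positivity)

theorem gapError_succ_le {d : ℕ} (hd : 2 ≤ d) (x : Set ℕ) (k : ℕ) :
    gapError d x (k + 1) ≤ gapError d x k * (1 / 2) := by
  obtain ⟨e, -, he, h⟩ := exists_gapError_eq d x k
  obtain ⟨e', he', -, h'⟩ := exists_gapError_eq d x (k + 1)
  have hd' : (2 : ℝ) ≤ d := by exact_mod_cast hd
  have hle : e + 1 ≤ e' := by nlinarith
  rw [h, h', one_div, ← mul_inv]
  refine inv_anti₀ (by positivity) ?_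
  calc (d : ℝ) ^ e * 2 ≤ d ^ e * d := by gcongr
    _ = (d : ℝ) ^ (e + 1) := (pow_succ _ _).symm
    _ ≤ d ^ e' := pow_le_pow_right₀ (by linarith) hle

theorem gapError_add_le {d : ℕ} (hd : 2 ≤ d) (x : Set ℕ) (k j : ℕ) :
    gapError d x (j + k) ≤ gapError d x k * (1 / 2) ^ j := by
  induction j with
  | zero => simp
  | succ j ih =>
    rw [pow_succ, ← mul_assoc, add_right_comm]
    exact (gapError_succ_le hd x _).trans (by gcongr)

/-- The reals `r` such that `d ^ k ^ 2 * r` is within `O(gapWeight d x k)` of an integer. -/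
noncomputable def gapGroup (d : ℕ) (x : Set ℕ) : AddSubgroup ℝ where
  carrier := {r | ∃ N : ℕ, ∀ k,
    ‖(((d : ℝ) ^ k ^ 2 * r : ℝ) : UnitAddCircle)‖ ≤ N * gapWeight d x k}
  zero_mem' := ⟨0, by simp⟩
  add_mem' := by
    rintro r s ⟨M, hM⟩ ⟨N, hN⟩
    refine ⟨M + N, fun k => ?_⟩
    rw [mul_add, AddCircle.coe_add, Nat.cast_add, add_mul]
    exact (norm_add_le _ _).trans (add_le_add (hM k) (hN k))
  neg_mem' := by
    rintro r ⟨M, hM⟩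
    refine ⟨M, fun k => ?_⟩
    rw [mul_neg, AddCircle.coe_neg, norm_neg]
    exact hM k

theorem isClosed_setOf_gap (d : ℕ) (w : ℕ → ℝ) (c : ℝ) : IsClosed {r : ℝ | ∀ k,
    ‖(((d : ℝ) ^ k ^ 2 * (c * r) : ℝ) : UnitAddCircle)‖ ≤ w k} := by
  rw [ofPred_forall]
  refine isClosed_iInter fun k => isClosed_le (Continuous.norm ?_) continuous_const
  exact (AddCircle.continuous_mk' 1).comp (by fun_prop)

theorem one_mem_gapGroup (d : ℕ) (x : Set ℕ) : (1 : ℝ) ∈ gapGroup d x := by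
  refine ⟨0, fun k => ?_⟩
  refine (UnitAddCircle.norm_coe_le _ ((d : ℤ) ^ k ^ 2)).trans ?_
  simp

theorem gapGroup_mono {d : ℕ} (hd : 2 ≤ d) {x y : Set ℕ} (h : (x \ y).Finite) :
    gapGroup d x ≤ gapGroup d y := by
  rintro r ⟨N, hN⟩
  have hd' : (1 : ℝ) ≤ d := by exact_mod_cast (by omega : 1 ≤ d)
  obtain ⟨K, hK⟩ := h.bddAbove
  refine ⟨N * d ^ K, fun k => (hN k).trans ?_⟩
  push_cast
  rw [mul_assoc]
  gcongr
  have hone : (1 : ℝ) ≤ d ^ K := one_le_pow₀ hd'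
  have hpos := gapWeight_pos hd y k
  by_cases hx : k ∈ x <;> by_cases hy : k ∈ y
  · rw [show gapWeight d x k = gapWeight d y k by simp [gapWeight, hx, hy]]
    nlinarith
  · have hk : (d : ℝ) ^ k ≤ d ^ K := pow_le_pow_right₀ hd' (hK ⟨hx, hy⟩)
    rw [show gapWeight d x k = d ^ k * gapWeight d y k by
      simp only [gapWeight, hx, hy, if_true, if_false]
      rw [two_mul, pow_add]
      field_simp]
    gcongr
  · refine le_trans ?_ (le_mul_of_one_le_left hpos.le hone)
    simp only [gapWeight, hx, hy, if_true, if_false]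
    exact inv_anti₀ (by positivity) (pow_le_pow_right₀ hd' (by omega))
  · rw [show gapWeight d x k = gapWeight d y k by simp [gapWeight, hx, hy]]
    nlinarith

theorem summable_of_le_gapError {d : ℕ} (hd : 2 ≤ d) {x : Set ℕ} {b : ℕ → ℝ} {N : ℝ}
    (hb : ∀ k, |b k| ≤ N * gapError d x k) : Summable b := by
  have hN : 0 ≤ N := by
    have := (abs_nonneg _).trans (hb 0)
    exact nonneg_of_mul_nonneg_left this (gapError_pos hd x 0)
  refine Summable.of_norm_bounded (g := fun k => N * (gapError d x 0 * (1 / 2) ^ k))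
    ((summable_geometric_two.mul_left _).mul_left _) fun k => (hb k).trans ?_
  gcongr
  exact gapError_add_le hd x 0 k

theorem tsum_mem_gapGroup {d : ℕ} (hd : 2 ≤ d) {x : Set ℕ} {b : ℕ → ℝ} {N : ℕ}
    (hb : ∀ k, |b k| ≤ N * gapError d x k)
    (hint : ∀ k, ∃ z : ℤ, (d : ℝ) ^ (k + 1) ^ 2 * b k = z) : ∑' k, b k ∈ gapGroup d x := by
  have hs := summable_of_le_gapError hd hb
  have hd' : (0 : ℝ) < d := by positivity
  choose z hz using hint
  refine ⟨2 * N, fun k => ?_⟩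
  have hsum : (d : ℝ) ^ k ^ 2 * ∑ j ∈ Finset.range k, b j =
      (∑ j ∈ Finset.range k, (d : ℤ) ^ (k ^ 2 - (j + 1) ^ 2) * z j : ℤ) := by
    rw [Finset.mul_sum]
    push_cast
    refine Finset.sum_congr rfl fun j hj => ?_
    have hle : (j + 1) ^ 2 ≤ k ^ 2 := Nat.pow_le_pow_left (by simpa using hj) 2
    rw [← hz j, ← mul_assoc, ← pow_add, Nat.sub_add_cancel hle]
  refine (UnitAddCircle.norm_coe_le _ _).trans (b := |(d : ℝ) ^ k ^ 2 * ∑' k, b k -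
      (∑ j ∈ Finset.range k, (d : ℤ) ^ (k ^ 2 - (j + 1) ^ 2) * z j : ℤ)|) ?_
  rw [← hsum, ← mul_sub, ← hs.sum_add_tsum_nat_add k, add_sub_cancel_left, abs_mul,
    abs_of_pos (by positivity)]
  have htail : ‖∑' j, b (j + k)‖ ≤ N * gapError d x k * 2 := by
    refine tsum_of_norm_bounded (hasSum_geometric_two.mul_left _) fun j => ?_
    refine (hb _).trans ?_
    rw [mul_assoc]
    gcongr
    exact gapError_add_le hd x k j
  calc (d : ℝ) ^ k ^ 2 * |∑' j, b (j + k)|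
      ≤ (d : ℝ) ^ k ^ 2 * (N * gapError d x k * 2) := by gcongr; exact htail
    _ = (2 * N : ℕ) * gapWeight d x k := by
      unfold gapError
      push_cast
      field_simp

theorem subsum_mem_gapGroup {d : ℕ} (hd : 2 ≤ d) {x : Set ℕ} {b : ℕ → ℝ} {N : ℕ}
    (hb : ∀ k, |b k| ≤ N * gapError d x k)
    (hint : ∀ k, ∃ z : ℤ, (d : ℝ) ^ (k + 1) ^ 2 * b k = z) (A : ℕ → Bool) :
    subsum b A ∈ gapGroup d x := by
  refine tsum_mem_gapGroup hd (N := N) (fun k => ?_) fun k => ?_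
  · split_ifs
    · exact hb k
    · simpa using (abs_nonneg _).trans (hb k)
  · split_ifs
    · exact hint k
    · exact ⟨0, by simp⟩

/-- Every element of `gapGroup d x` differs by an integer from the sum of a series of
`d`-adic fractions, all of whose subsums lie in `gapGroup d x`. -/
theorem exists_series_of_mem_gapGroup {d : ℕ} (hd : 2 ≤ d) {x : Set ℕ} {r : ℝ}
    (hr : r ∈ gapGroup d x) : ∃ (z : ℤ) (b : ℕ → ℝ) (N : ℕ), r = z + ∑' k, b k ∧
      (∀ k, |b k| ≤ N * gapError d x k) ∧
      ∀ k, ∃ z : ℤ, (d : ℝ) ^ (k + 1) ^ 2 * b k = z := by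
  obtain ⟨N, hN⟩ := hr
  have hd' : (0 : ℝ) < d := by positivity
  set a : ℕ → ℝ := fun k => round ((d : ℝ) ^ k ^ 2 * r) / (d : ℝ) ^ k ^ 2 with ha
  have happ : ∀ k, |a k - r| ≤ N * gapError d x k := by
    intro k
    have h := hN k
    rw [UnitAddCircle.norm_eq] at h
    rw [show a k - r = -(((d : ℝ) ^ k ^ 2 * r - round ((d : ℝ) ^ k ^ 2 * r)) / (d : ℝ) ^ k ^ 2) by
      simp only [ha]
      field_simp
      ring, abs_neg, abs_div, abs_of_pos (a := (d : ℝ) ^ k ^ 2) (by positivity), gapError,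
      ← mul_div_assoc]
    gcongr
  have hb : ∀ k, |a (k + 1) - a k| ≤ (2 * N : ℕ) * gapError d x k := by
    intro k
    have h1 := happ k
    have h2 := happ (k + 1)
    have h3 := gapError_succ_le hd x k
    have h4 : N * gapError d x (k + 1) ≤ N * gapError d x k := by
      have := gapError_pos hd x k
      gcongr
      linarith
    calc |a (k + 1) - a k| = |(a (k + 1) - r) - (a k - r)| := by ring_nf
      _ ≤ |a (k + 1) - r| + |a k - r| := abs_sub _ _
      _ ≤ (2 * N : ℕ) * gapError d x k := by push_cast; linarith
  have hlim : Tendsto a atTop (nhds r) := by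
    rw [tendsto_iff_norm_sub_tendsto_zero]
    have h0 : Tendsto (fun k => N * (gapError d x 0 * (1 / 2 : ℝ) ^ k)) atTop (nhds 0) := by
      simpa using ((tendsto_pow_atTop_nhds_zero_of_lt_one (r := (1 / 2 : ℝ)) (by norm_num)
        (by norm_num)).const_mul (gapError d x 0)).const_mul (N : ℝ)
    refine squeeze_zero (fun _ => norm_nonneg _) (fun k => (happ k).trans ?_) h0
    gcongr
    exact gapError_add_le hd x 0 k
  refine ⟨round r, fun k => a (k + 1) - a k, 2 * N, ?_, hb, fun k => ?_⟩
  · have hs := (summable_of_le_gapError hd hb).hasSum.tendsto_sum_nat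
    simp only [Finset.sum_range_sub] at hs
    have := tendsto_nhds_unique hs (hlim.sub_const _)
    rw [this]
    simp [ha]
  · refine ⟨round ((d : ℝ) ^ (k + 1) ^ 2 * r) - d ^ (2 * k + 1) * round ((d : ℝ) ^ k ^ 2 * r), ?_⟩
    simp only [ha]
    push_cast
    rw [show (k + 1) ^ 2 = k ^ 2 + (2 * k + 1) by ring, pow_add]
    field_simp

/-- The `R`-submodule of `ℝ` generated by `gapGroup d x`. -/
noncomputable def gapModule (R : Subring ℚ) (d : ℕ) (x : Set ℕ) : AddSubgroup ℝ where
  carrier := {r | ∃ m : ℕ, m ≠ 0 ∧ (m : ℚ)⁻¹ ∈ R ∧ (m : ℝ) * r ∈ gapGroup d x}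
  zero_mem' := ⟨1, one_ne_zero, by simp, by simp [zero_mem]⟩
  add_mem' := by
    rintro r s ⟨m, hm, hmR, hr⟩ ⟨n, hn, hnR, hs⟩
    refine ⟨m * n, mul_ne_zero hm hn, ?_, ?_⟩
    · rw [Nat.cast_mul, mul_inv]
      exact R.mul_mem hmR hnR
    · have := add_mem (nsmul_mem hr n) (nsmul_mem hs m)
      simp only [nsmul_eq_mul] at this
      convert this using 1
      push_cast
      ring
  neg_mem' := by
    rintro r ⟨m, hm, hmR, hr⟩
    exact ⟨m, hm, hmR, by rw [mul_neg]; exact neg_mem hr⟩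

theorem mem_gapModule {R : Subring ℚ} {d : ℕ} {x : Set ℕ} {r : ℝ} : r ∈ gapModule R d x ↔
    ∃ m : ℕ, m ≠ 0 ∧ (m : ℚ)⁻¹ ∈ R ∧ (m : ℝ) * r ∈ gapGroup d x := Iff.rfl

theorem gapGroup_le_gapModule (R : Subring ℚ) (d : ℕ) (x : Set ℕ) :
    gapGroup d x ≤ gapModule R d x :=
  fun r hr => ⟨1, one_ne_zero, by simp, by simpa using hr⟩

theorem gapModule_mono (R : Subring ℚ) {d : ℕ} (hd : 2 ≤ d) {x y : Set ℕ} (h : (x \ y).Finite) :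
    gapModule R d x ≤ gapModule R d y := by
  rintro r ⟨m, hm, hmR, hr⟩
  exact ⟨m, hm, hmR, gapGroup_mono hd h hr⟩

theorem mul_mem_gapModule {R : Subring ℚ} {d : ℕ} {x : Set ℕ} {q : ℚ} (hq : q ∈ R) {r : ℝ}
    (hr : r ∈ gapModule R d x) : (q : ℝ) * r ∈ gapModule R d x := by
  obtain ⟨m, hm, hmR, hr⟩ := hr
  refine ⟨q.den * m, mul_ne_zero q.den_nz hm, ?_, ?_⟩
  · rw [Nat.cast_mul, mul_inv]
    exact R.mul_mem (Subring.inv_den_mem hq) hmR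
  · have h : ((q.den : ℝ) * q) = q.num := by exact_mod_cast Rat.den_mul_eq_num q
    have := zsmul_mem hr q.num
    rw [zsmul_eq_mul] at this
    convert this using 1
    rw [← h]
    push_cast
    ring

open Classical in
/-- The closed pieces of `gapModule R d x`. -/
noncomputable def gapPiece (R : Subring ℚ) (d : ℕ) (x : Set ℕ) (i : ℕ) : Set ℝ :=
  if i.unpair.1 ≠ 0 ∧ (i.unpair.1 : ℚ)⁻¹ ∈ R then
    {r : ℝ | ∀ k, ‖(((d : ℝ) ^ k ^ 2 * ((i.unpair.1 : ℝ) * r) : ℝ) : UnitAddCircle)‖ ≤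
      i.unpair.2 * gapWeight d x k}
  else ∅

theorem isClosed_gapPiece (R : Subring ℚ) (d : ℕ) (x : Set ℕ) (i : ℕ) :
    IsClosed (gapPiece R d x i) := by
  unfold gapPiece
  split_ifs
  · exact isClosed_setOf_gap d _ _
  · exact isClosed_empty

theorem coe_gapModule_eq_iUnion (R : Subring ℚ) (d : ℕ) (x : Set ℕ) :
    (gapModule R d x : Set ℝ) = ⋃ i, gapPiece R d x i := by
  ext r
  rw [SetLike.mem_coe, mem_gapModule, mem_iUnion]
  constructor
  · rintro ⟨m, hm, hmR, N, hN⟩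
    refine ⟨Nat.pair m N, ?_⟩
    rw [gapPiece, if_pos (by simpa using ⟨hm, hmR⟩)]
    simpa using hN
  · rintro ⟨i, hi⟩
    unfold gapPiece at hi
    split_ifs at hi with h
    · exact ⟨_, h.1, h.2, _, hi⟩
    · exact hi.elim

theorem subsum_gapError_mem_gapGroup {d : ℕ} (hd : 2 ≤ d) (x : Set ℕ) (A : ℕ → Bool) :
    subsum (gapError d x) A ∈ gapGroup d x := by
  refine subsum_mem_gapGroup hd (N := 1) (fun k => ?_) (fun k => ?_) A
  · rw [abs_of_pos (gapError_pos hd x k), Nat.cast_one, one_mul]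
  · obtain ⟨e, -, he, h⟩ := exists_gapError_eq d x k
    have hd' : (d : ℝ) ≠ 0 := by positivity
    refine ⟨(d : ℤ) ^ ((k + 1) ^ 2 - e), ?_⟩
    have hle : e ≤ (k + 1) ^ 2 := by nlinarith
    rw [h, ← pow_sub₀ _ hd' hle]
    push_cast
    rfl

theorem summable_gapError {d : ℕ} (hd : 2 ≤ d) (x : Set ℕ) : Summable (gapError d x) :=
  summable_of_le_gapError hd (x := x) (N := 1) fun k => by
    rw [abs_of_pos (gapError_pos hd x k), one_mul]

theorem not_countable_gapGroup {d : ℕ} (hd : 2 ≤ d) (x : Set ℕ) :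
    ¬ (gapGroup d x : Set ℝ).Countable := by
  intro hc
  have : Countable (gapGroup d x) := hc.to_subtype
  obtain ⟨i, K, h⟩ := exists_sub_eq_of_subsum_mem (summable_gapError hd x)
    (C := fun i : gapGroup d x => {(i : ℝ)}) (fun i => isClosed_singleton)
    fun A => ⟨⟨_, subsum_gapError_mem_gapGroup hd x A⟩, rfl⟩
  obtain ⟨u, hu, v, hv, huv⟩ := h K le_rfl
  have := gapError_pos hd x K
  rw [mem_singleton_iff] at hu hv
  linarith

theorem eq_zero_of_mul_mem_gapModule {R : Subring ℚ} {d : ℕ} (hd : 2 ≤ d) {x y : Set ℕ}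
    (hxy : (x \ y).Infinite) {c : ℝ} (hc : ∀ r ∈ gapGroup d x, c * r ∈ gapModule R d y) :
    c = 0 := by
  obtain ⟨i, K, h⟩ := exists_sub_eq_of_subsum_mem (summable_gapError hd x)
    (C := fun i => (fun r => c * r) ⁻¹' gapPiece R d y i)
    (fun i => (isClosed_gapPiece R d y i).preimage (by fun_prop)) fun A => by
      have := hc _ (subsum_gapError_mem_gapGroup hd x A)
      rwa [← SetLike.mem_coe, coe_gapModule_eq_iUnion, mem_iUnion] at this
  by_contra hc0
  simp only [gapPiece, mem_preimage] at h
  split_ifs at h with hm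
  swap
  · obtain ⟨u, hu, -⟩ := h K le_rfl
    exact hu
  set m := i.unpair.1
  set N := i.unpair.2
  have hd' : (2 : ℝ) ≤ d := by exact_mod_cast hd
  have hmc : 0 < |(m : ℝ) * c| := abs_pos.2 (mul_ne_zero (by exact_mod_cast hm.1) hc0)
  have hlim : Tendsto (fun k : ℕ => (d : ℝ) ^ k) atTop atTop :=
    tendsto_pow_atTop_atTop_of_one_lt (by linarith)
  obtain ⟨K', hK'⟩ := eventually_atTop.1 ((hlim.eventually_gt_atTop (2 * |(m : ℝ) * c|)).and
    (hlim.eventually_gt_atTop (2 * N / |(m : ℝ) * c|)))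
  obtain ⟨k, ⟨hkx, hky⟩, hk⟩ := hxy.exists_gt (max K K')
  obtain ⟨u, hu, v, hv, huv⟩ := h k (by omega)
  obtain ⟨h1, h2⟩ := hK' k (by omega)
  have hpos : (0 : ℝ) < d ^ k := by positivity
  have hval : (d : ℝ) ^ k ^ 2 * (m * (c * u)) - (d : ℝ) ^ k ^ 2 * (m * (c * v)) =
      m * c * ((d : ℝ) ^ k)⁻¹ := by
    rw [show (d : ℝ) ^ k ^ 2 * (m * (c * u)) - (d : ℝ) ^ k ^ 2 * (m * (c * v)) =
      m * c * ((d : ℝ) ^ k ^ 2 * (u - v)) by ring, huv]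
    simp only [gapError, gapWeight, hkx, if_true]
    field_simp
  have hnorm := (norm_sub_le _ _).trans (add_le_add (hu k) (hv k))
  rw [← AddCircle.coe_sub, hval, (AddCircle.norm_coe_eq_abs_iff 1 one_ne_zero).2, abs_mul,
    abs_of_pos (inv_pos.2 hpos)] at hnorm
  · simp only [gapWeight, hky, if_false, two_mul, pow_add] at hnorm
    rw [div_lt_iff₀ hmc] at h2
    have := mul_le_mul_of_nonneg_right hnorm (mul_pos hpos hpos).le
    field_simp at this
    linarith
  · rw [abs_mul, abs_of_pos (inv_pos.2 hpos), abs_one, ← div_eq_mul_inv, div_le_iff₀ hpos]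
    linarith

/-- A Borel `R`-module homomorphism from `gapModule R d x` to `ℝ` is multiplication by its
value at `1`. -/
theorem eq_mul_of_measurable {R : Subring ℚ} {d : ℕ} (hd : 2 ≤ d) (hdR : (d : ℚ)⁻¹ ∈ R)
    {x : Set ℕ} (f : gapModule R d x →+ ℝ) (hf : Measurable f)
    (hfR : ∀ (q : ℚ) (hq : q ∈ R) (r : gapModule R d x),
      f ⟨q * r, mul_mem_gapModule hq r.2⟩ = q * f r)
    (r : gapModule R d x) :
    f r = f ⟨1, gapGroup_le_gapModule R d x (one_mem_gapGroup d x)⟩ * r := by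
  set e : gapModule R d x := ⟨1, gapGroup_le_gapModule R d x (one_mem_gapGroup d x)⟩ with he
  obtain ⟨g, hgapp⟩ : ∃ g : gapModule R d x →+ ℝ, ∀ v, g v = f v - f e * v :=
    ⟨f - (AddMonoidHom.mulLeft (f e)).comp (gapModule R d x).subtype, fun v => rfl⟩
  have hg : Measurable g := by
    rw [show (g : gapModule R d x → ℝ) = fun v => f v - f e * v from funext hgapp]
    exact hf.sub (measurable_subtype_coe.const_mul _)
  have hmul : ∀ q ∈ R, ∀ v w : gapModule R d x, (w : ℝ) = q * v → g w = q * g v := by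
    intro q hq v w hw
    have hfw : f w = q * f v := (congrArg f (Subtype.ext hw)).trans (hfR q hq v)
    rw [hgapp, hgapp, hw, hfw]
    ring
  have hge : g e = 0 := by simp [hgapp, he]
  have hrat : ∀ q ∈ R, ∀ w : gapModule R d x, (w : ℝ) = q → g w = 0 := by
    intro q hq w hw
    rw [hmul q hq e w (by simp [he, hw]), hge, mul_zero]
  have hgap : ∀ v : gapModule R d x, (v : ℝ) ∈ gapGroup d x → g v = 0 := by
    intro v hv
    obtain ⟨z, b, N, hvb, hb, hint⟩ := exists_series_of_mem_gapGroup hd hv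
    have hG := fun A => gapGroup_le_gapModule R d x (subsum_mem_gapGroup hd hb hint A)
    have hbG : ∀ k, b k ∈ gapModule R d x := fun k => subsum_single b k ▸ hG _
    have hz : (z : ℝ) ∈ gapModule R d x := by
      simpa [he] using mul_mem_gapModule (intCast_mem R z) e.2
    have h0 := map_tsum_eq_zero g hg (summable_of_le_gapError hd hb) hG hbG fun k => by
      obtain ⟨w, hw⟩ := hint k
      refine hrat (w * ((d : ℚ)⁻¹) ^ (k + 1) ^ 2)
        (R.mul_mem (intCast_mem R w) (R.pow_mem hdR _)) _ ?_
      have hd' : (d : ℝ) ≠ 0 := by positivity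
      push_cast
      rw [← hw, inv_pow]
      field_simp
    have hsum : v = ⟨z, hz⟩ + ⟨subsum b fun _ => true, hG _⟩ :=
      Subtype.ext (by simp [hvb, subsum_true])
    rw [hsum, map_add, h0, add_zero]
    exact hrat z (intCast_mem R z) _ (by simp)
  obtain ⟨m, hm, -, hmr⟩ := r.2
  have h := hmul m (natCast_mem R m) r ⟨m * r, gapGroup_le_gapModule R d x hmr⟩ (by simp)
  rw [hgap ⟨m * r, gapGroup_le_gapModule R d x hmr⟩ hmr, eq_comm, mul_eq_zero,
    or_iff_right (by exact_mod_cast hm), hgapp] at h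
  linarith

/-- Corollary A: for a subring `R` of ℚ with `R ≠ ℤ`, there is a family
`F x`, `x ⊆ ℕ`, of uncountable Fσ `R`-submodules of ℝ, monotone under almost-inclusion
of indices, such that if `x \ y` is infinite then every Borel `R`-module homomorphism
`F x → F y` is zero. -/
theorem corollary_A (R : Subring ℚ)
    (hR : (R : Set ℚ) ≠ Set.range (Int.cast : ℤ → ℚ)) :
    ∃ F : Set ℕ → Set ℝ,
      -- each `F x` is uncountable
      (∀ x : Set ℕ, ¬ (F x).Countable) ∧
      -- each `F x` is a countable union of closed subsets of ℝ
      (∀ x : Set ℕ, ∃ C : ℕ → Set ℝ, (∀ k, IsClosed (C k)) ∧ F x = ⋃ k, C k) ∧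
      -- each `F x` is an `R`-submodule of ℝ
      (∀ x : Set ℕ, (0 : ℝ) ∈ F x ∧
        (∀ r ∈ F x, ∀ s ∈ F x, r + s ∈ F x) ∧
        (∀ r ∈ F x, -r ∈ F x) ∧
        (∀ q : ℚ, q ∈ R → ∀ r ∈ F x, (q : ℝ) * r ∈ F x)) ∧
      -- (i) if `x \ y` is finite then `F x ⊆ F y`
      (∀ x y : Set ℕ, (x \ y).Finite → F x ⊆ F y) ∧
      -- (ii) if `x \ y` is infinite then every Borel `R`-module homomorphism
      -- `F x → F y` is constantly zero
      (∀ x y : Set ℕ, (x \ y).Infinite → ∀ f : ℝ → ℝ,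
        Set.MapsTo f (F x) (F y) →
        Measurable ((F x).restrict f) →
        (∀ r ∈ F x, ∀ s ∈ F x, f (r + s) = f r + f s) →
        (∀ q : ℚ, q ∈ R → ∀ r ∈ F x, f ((q : ℝ) * r) = (q : ℝ) * f r) →
        ∀ r ∈ F x, f r = 0) := by
  obtain ⟨d, hd, hdR⟩ := Subring.exists_two_le_inv_mem hR
  refine ⟨fun x => gapModule R d x, fun x hx => ?_, fun x => ?_, fun x => ?_, fun x y h => ?_,
    fun x y hxy f hmaps hmeas hadd hsmul r hr => ?_⟩
  · exact not_countable_gapGroup hd x (hx.mono (gapGroup_le_gapModule R d x))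
  · exact ⟨gapPiece R d x, isClosed_gapPiece R d x, coe_gapModule_eq_iUnion R d x⟩
  · exact ⟨zero_mem _, fun r hr s hs => add_mem hr hs, fun r hr => neg_mem hr,
      fun q hq r hr => mul_mem_gapModule hq hr⟩
  · exact gapModule_mono R hd h
  · let φ : gapModule R d x →+ ℝ :=
      AddMonoidHom.mk' (fun v => f v) fun v w => hadd v v.2 w w.2
    have hφ : ∀ s, ∀ hs : s ∈ gapModule R d x, f s = f 1 * s := fun s hs =>
      eq_mul_of_measurable hd hdR φ hmeas (fun q hq v => hsmul q hq v v.2) ⟨s, hs⟩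
    have hc : f 1 = 0 := eq_zero_of_mul_mem_gapModule (R := R) hd hxy fun s hs => by
      rw [← hφ s (gapGroup_le_gapModule R d x hs)]
      exact hmaps (gapGroup_le_gapModule R d x hs)
    rw [hφ r hr, hc, zero_mul]
end

section
/- Let φ be an lsc submeasure, suppose I = Exh(φ) is a translation invariant ideal, and let a be a base sequence adapted to I. Let H = { r ∈ ℝ : j_a(|r|) ∈ I } and for r, s ∈ H let ρ(r,s) = φ(j_a(|r−s|)) + |r−s|. Then H is an additive subgroup of ℝ closed under multiplication by every element of ℚ_a, and there exists a metric d on H such that: (1) for each ε > 0 there is δ > 0 with (ρ(r,s) < δ ⇒ d(r,s) < ε) and (d(r,s) < δ ⇒ ρ(r,s) < ε) for all r, s ∈ H; (2) the metric space (H, d) is complete and separable; (3) the topology induced by d on H refines the topology H inherits from ℝ; (4) addition H × H → H and negation H → H are continuous for the d-topology; (5) for each q ∈ ℚ_a, the map r ↦ q·r is continuous from (H, d) to (H, d). -/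
open Set Filter
open scoped ENNReal

/-! ### Digits and carries -/

lemma bProd_eq_intCast (a : ℕ → ℕ) (n : ℕ) :
    bProd a n = ((∏ k ∈ Finset.range n, (a k : ℤ) : ℤ) : ℝ) := by
  simp [bProd]

lemma bProd_succ (a : ℕ → ℕ) (n : ℕ) : bProd a (n + 1) = a n * bProd a n := by
  simp [bProd, Finset.prod_range_succ, mul_comm]

lemma bProd_pos {a : ℕ → ℕ} (ha : ∀ n, 2 ≤ a n) (n : ℕ) : 0 < bProd a n :=
  Finset.prod_pos fun k _ => by
    have := ha k
    exact_mod_cast (by omega : 0 < a k)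

lemma bProd_mono {a : ℕ → ℕ} (ha : ∀ n, 2 ≤ a n) : Monotone (bProd a) := by
  refine monotone_nat_of_le_succ fun n => ?_
  rw [bProd_succ]
  have h : (1 : ℝ) ≤ a n := by exact_mod_cast (one_le_two.trans (ha n))
  nlinarith [bProd_pos ha n]

lemma digit_eq (a : ℕ → ℕ) (r : ℝ) (n : ℕ) :
    digit a r n = ⌊bProd a (n + 1) * r⌋ - (a n : ℤ) * ⌊bProd a n * r⌋ := by
  have h : ∀ m, ⌊bProd a m * Int.fract r⌋ =
      ⌊bProd a m * r⌋ - (∏ k ∈ Finset.range m, (a k : ℤ)) * ⌊r⌋ := by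
    intro m
    rw [← Int.floor_sub_intCast]
    congr 1
    rw [Int.fract, bProd_eq_intCast]
    push_cast
    ring
  rw [digit, h, h, Finset.prod_range_succ]
  ring

lemma digit_nonneg (a : ℕ → ℕ) (r : ℝ) (n : ℕ) : 0 ≤ digit a r n := by
  rw [digit_eq, sub_nonneg, Int.le_floor, bProd_succ, mul_assoc]
  push_cast
  exact mul_le_mul_of_nonneg_left (Int.floor_le _) (Nat.cast_nonneg _)

lemma digit_lt {a : ℕ → ℕ} (ha : ∀ n, 2 ≤ a n) (r : ℝ) (n : ℕ) : digit a r n < a n := by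
  rw [digit_eq, sub_lt_iff_lt_add, Int.floor_lt, bProd_succ, mul_assoc]
  push_cast
  have h : (0 : ℝ) < a n := by exact_mod_cast (by have := ha n; omega : 0 < a n)
  nlinarith [Int.lt_floor_add_one (bProd a n * r)]

/-- The positions at which the base sequence changes. -/
def baseJumps (a : ℕ → ℕ) : Set ℕ := {n | a n ≠ a (n + 1)}

/-- A set together with its translates by one in both directions. -/
def thicken (x : Set ℕ) : Set ℕ := {n | n ∈ x ∨ n + 1 ∈ x ∨ ∃ m ∈ x, n = m + 1}

lemma thicken_mono {x y : Set ℕ} (h : x ⊆ y) : thicken x ⊆ thicken y := by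
  rintro n (hn | hn | ⟨m, hm, rfl⟩)
  · exact Or.inl (h hn)
  · exact Or.inr (Or.inl (h hn))
  · exact Or.inr (Or.inr ⟨m, h hm, rfl⟩)

/-- The carry into position `n` when `x` and `y` are added to give `z`. -/
noncomputable def carry (a : ℕ → ℕ) (x y z : ℝ) (n : ℕ) : ℤ :=
  ⌊bProd a n * z⌋ - ⌊bProd a n * x⌋ - ⌊bProd a n * y⌋

lemma digit_add_carry (a : ℕ → ℕ) (x y z : ℝ) (n : ℕ) :
    digit a z n = digit a x n + digit a y n + carry a x y z (n + 1) - a n * carry a x y z n := by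
  simp only [digit_eq, carry]
  ring

lemma carry_add (a : ℕ → ℕ) (x y : ℝ) (n : ℕ) :
    carry a x y (x + y) n = 0 ∨ carry a x y (x + y) n = 1 := by
  have h1 := Int.le_floor_add (bProd a n * x) (bProd a n * y)
  have h2 := Int.le_floor_add_floor (bProd a n * x) (bProd a n * y)
  rw [carry, mul_add]
  omega

lemma carry_window {b d e c₀ c₁ c₂ c₃ f₀ f₁ f₂ : ℤ} (h₀ : c₀ = 0 ∨ c₀ = 1) (h₁ : c₁ = 0 ∨ c₁ = 1)
    (h₂ : c₂ = 0 ∨ c₂ = 1) (h₃ : c₃ = 0 ∨ c₃ = 1) (e₀ : f₀ = d + e + c₁ - b * c₀)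
    (e₁ : f₁ = d + e + c₂ - b * c₁) (e₂ : f₂ = d + e + c₃ - b * c₂)
    (l₀ : 0 ≤ f₀) (l₁ : 0 ≤ f₁) (l₂ : 0 ≤ f₂) (u₀ : f₀ < b) (u₁ : f₁ < b) (u₂ : f₂ < b) :
    f₀ = f₁ := by
  rcases h₀ with rfl | rfl <;> rcases h₁ with rfl | rfl <;> rcases h₂ with rfl | rfl <;>
    rcases h₃ with rfl | rfl <;> omega

lemma borrow_window {b d f c₀ c₁ c₂ c₃ e₀ e₁ e₂ : ℤ} (h₀ : c₀ = 0 ∨ c₀ = 1) (h₁ : c₁ = 0 ∨ c₁ = 1)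
    (h₂ : c₂ = 0 ∨ c₂ = 1) (h₃ : c₃ = 0 ∨ c₃ = 1) (q₀ : f = d + e₀ + c₁ - b * c₀)
    (q₁ : f = d + e₁ + c₂ - b * c₁) (q₂ : f = d + e₂ + c₃ - b * c₂)
    (l₀ : 0 ≤ e₀) (l₁ : 0 ≤ e₁) (l₂ : 0 ≤ e₂) (u₀ : e₀ < b) (u₁ : e₁ < b) (u₂ : e₂ < b) :
    e₀ = e₁ := by
  rcases h₀ with rfl | rfl <;> rcases h₁ with rfl | rfl <;> rcases h₂ with rfl | rfl <;>
    rcases h₃ with rfl | rfl <;> omega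

lemma notMem_jSet {a : ℕ → ℕ} {r : ℝ} {n : ℕ} :
    n ∉ jSet a r ↔ digit a r n = digit a r (n + 1) := by
  simp [jSet]

lemma notMem_baseJumps {a : ℕ → ℕ} {n : ℕ} : n ∉ baseJumps a ↔ a n = a (n + 1) := by
  simp [baseJumps]

lemma notMem_thicken {x : Set ℕ} {n : ℕ} :
    n ∉ thicken x ↔ n ∉ x ∧ n + 1 ∉ x ∧ ∀ m ∈ x, n ≠ m + 1 := by
  simp [thicken]

lemma mem_thicken_of_carry {a : ℕ → ℕ} (ha : ∀ n, 2 ≤ a n) {x y z : ℝ} {n : ℕ}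
    (hc : ∀ k ≤ n + 3, carry a x y z k = 0 ∨ carry a x y z k = 1) (hn : n ∈ jSet a z) :
    n ∈ thicken (jSet a x ∪ jSet a y ∪ baseJumps a) := by
  by_contra h
  simp only [notMem_thicken, mem_union, not_or, notMem_jSet, notMem_baseJumps] at h
  obtain ⟨⟨⟨x₀, y₀⟩, a₀⟩, ⟨⟨x₁, y₁⟩, a₁⟩, -⟩ := h
  refine hn ?_
  have e₀ := digit_add_carry a x y z n
  have e₁ := digit_add_carry a x y z (n + 1)
  have e₂ := digit_add_carry a x y z (n + 1 + 1)
  have u₀ := digit_lt ha z n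
  have u₁ := digit_lt ha z (n + 1)
  have u₂ := digit_lt ha z (n + 1 + 1)
  rw [← x₁, ← y₁, ← x₀, ← y₀, ← a₁, ← a₀] at e₂
  rw [← x₀, ← y₀, ← a₀] at e₁
  rw [← a₀] at u₁
  rw [← a₁, ← a₀] at u₂
  exact carry_window (hc n (by omega)) (hc (n + 1) (by omega)) (hc (n + 1 + 1) (by omega))
    (hc (n + 1 + 1 + 1) (by omega)) e₀ e₁ e₂ (digit_nonneg ..) (digit_nonneg ..)
    (digit_nonneg ..) u₀ u₁ u₂

lemma jSet_add_subset {a : ℕ → ℕ} (ha : ∀ n, 2 ≤ a n) (x y : ℝ) :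
    jSet a (x + y) ⊆ thicken (jSet a x ∪ jSet a y ∪ baseJumps a) :=
  fun _ hn => mem_thicken_of_carry ha (fun k _ => carry_add a x y k) hn

lemma jSet_sub_subset {a : ℕ → ℕ} (ha : ∀ n, 2 ≤ a n) (z x : ℝ) :
    jSet a (z - x) ⊆ thicken (jSet a z ∪ jSet a x ∪ baseJumps a) := by
  intro n hn
  by_contra h
  simp only [notMem_thicken, mem_union, not_or, notMem_jSet, notMem_baseJumps] at h
  obtain ⟨⟨⟨z₀, x₀⟩, a₀⟩, ⟨⟨z₁, x₁⟩, a₁⟩, -⟩ := h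
  refine hn ?_
  have hc : ∀ k, carry a x (z - x) z k = 0 ∨ carry a x (z - x) z k = 1 := by
    intro k
    simpa using carry_add a x (z - x) k
  have e₀ := digit_add_carry a x (z - x) z n
  have e₁ := digit_add_carry a x (z - x) z (n + 1)
  have e₂ := digit_add_carry a x (z - x) z (n + 1 + 1)
  have u₀ := digit_lt ha (z - x) n
  have u₁ := digit_lt ha (z - x) (n + 1)
  have u₂ := digit_lt ha (z - x) (n + 1 + 1)
  rw [← x₁, ← z₁, ← x₀, ← z₀, ← a₁, ← a₀] at e₂
  rw [← x₀, ← z₀, ← a₀] at e₁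
  rw [← a₀] at u₁
  rw [← a₁, ← a₀] at u₂
  exact borrow_window (hc n) (hc (n + 1)) (hc (n + 1 + 1)) (hc (n + 1 + 1 + 1)) e₀ e₁ e₂
    (digit_nonneg ..) (digit_nonneg ..) (digit_nonneg ..) u₀ u₁ u₂

lemma jSet_abs_add_subset {a : ℕ → ℕ} (ha : ∀ n, 2 ≤ a n) (r s : ℝ) :
    jSet a |r + s| ⊆ thicken (jSet a |r| ∪ jSet a |s| ∪ baseJumps a) := by
  have h : |r + s| = |r| + |s| ∨ |r + s| = |r| - |s| ∨ |r + s| = |s| - |r| := by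
    rcases abs_cases r with hr | hr <;> rcases abs_cases s with hs | hs <;>
      rcases abs_cases (r + s) with ht | ht <;> grind
  rcases h with h | h | h <;> rw [h]
  · exact jSet_add_subset ha _ _
  · exact jSet_sub_subset ha _ _
  · rw [union_comm (jSet a |r|)]
    exact jSet_sub_subset ha _ _

lemma jSet_abs_sub_subset {a : ℕ → ℕ} (ha : ∀ n, 2 ≤ a n) (r s : ℝ) :
    jSet a |r - s| ⊆ thicken (jSet a |r| ∪ jSet a |s| ∪ baseJumps a) := by
  simpa [sub_eq_add_neg] using jSet_abs_add_subset ha r (-s)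

lemma jSet_zero (a : ℕ → ℕ) : jSet a 0 = ∅ := by
  ext n
  simp [jSet, digit_eq]

lemma jSet_of_small {a : ℕ → ℕ} (ha : ∀ n, 2 ≤ a n) (N : ℕ) :
    ∃ η : ℝ, 0 < η ∧ ∀ t, 0 ≤ t → t < η → ∀ n ∈ jSet a t, N ≤ n := by
  have hP := bProd_pos ha (N + 1)
  refine ⟨(bProd a (N + 1))⁻¹, inv_pos.2 hP, fun t h0 ht n hn => ?_⟩
  by_contra! hlt
  refine hn ?_
  have hz : ∀ m ≤ N + 1, ⌊bProd a m * t⌋ = 0 := by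
    intro m hm
    rw [Int.floor_eq_zero_iff]
    refine ⟨mul_nonneg (bProd_pos ha m).le h0, ?_⟩
    calc bProd a m * t ≤ bProd a (N + 1) * t := mul_le_mul_of_nonneg_right (bProd_mono ha hm) h0
      _ < bProd a (N + 1) * (bProd a (N + 1))⁻¹ := mul_lt_mul_of_pos_left ht hP
      _ = 1 := mul_inv_cancel₀ hP.ne'
  rw [digit_eq, digit_eq, hz _ (by omega), hz _ (by omega), hz _ (by omega)]
  simp

/-- Lower semicontinuity of `jSet`, up to thickening. -/
lemma eventually_jSet_inter_subset {a : ℕ → ℕ} (ha : ∀ n, 2 ≤ a n) {u : ℕ → ℝ} {t : ℝ}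
    (hu : Tendsto u atTop (nhds t)) (K : ℕ) :
    ∀ᶠ m in atTop, jSet a t ∩ {k | k < K} ⊆ thicken (jSet a (u m) ∪ baseJumps a) := by
  have h : ∀ᶠ m in atTop, ∀ k ∈ Finset.range (K + 3),
      carry a (u m) 0 t k = 0 ∨ carry a (u m) 0 t k = 1 := by
    refine (Finset.eventually_all _).2 fun k _ => ?_
    have hk : Tendsto (fun m => bProd a k * u m) atTop (nhds (bProd a k * t)) :=
      hu.const_mul _
    filter_upwards [hk.eventually (Ioo_mem_nhds
      (lt_of_lt_of_le (sub_one_lt _) (Int.floor_le (bProd a k * t)))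
      (Int.lt_floor_add_one (bProd a k * t)))] with m hm
    have h1 : ⌊bProd a k * t⌋ - 1 ≤ ⌊bProd a k * u m⌋ := by
      rw [Int.le_floor]; push_cast; exact hm.1.le
    have h2 : ⌊bProd a k * u m⌋ < ⌊bProd a k * t⌋ + 1 := by
      rw [Int.floor_lt]; push_cast; exact hm.2
    simp only [carry, mul_zero, Int.floor_zero]
    omega
  filter_upwards [h] with m hm n hn
  have hnK : n < K := hn.2
  have := mem_thicken_of_carry ha
    (fun k hk => hm k (Finset.mem_range.2 (by omega))) hn.1
  rwa [jSet_zero, union_empty] at this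

/-- Division by a number `p` dividing almost all terms of the base sequence. -/
lemma jSet_div_subset {a : ℕ → ℕ} {p : ℕ} (hp : 0 < p) {N : ℕ}
    (hN : ∀ n ≥ N, p ∣ a n) (r : ℝ) {n : ℕ} (hn : n ∈ jSet a (r / p)) (hNn : N + 1 ≤ n) :
    n ∈ thicken (jSet a r ∪ baseJumps a) := by
  have hF : ∀ m, ⌊bProd a m * (r / p)⌋ = ⌊bProd a m * r⌋ / (p : ℤ) := by
    intro m
    rw [← mul_div_assoc, Int.floor_div_natCast]
  have hpz : (p : ℤ) ≠ 0 := by exact_mod_cast hp.ne'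
  -- the remainder of the integer part modulo `p` is that of the preceding digit
  have hm : ∀ m ≥ N, ⌊bProd a (m + 1) * r⌋ % (p : ℤ) = digit a r m % p := by
    intro m hm
    obtain ⟨q, hq⟩ := hN m hm
    rw [digit_eq, hq]
    push_cast
    rw [mul_assoc, Int.sub_mul_emod_self_left]
  have hd : ∀ m ≥ N, p * digit a (r / p) (m + 1) = digit a r (m + 1) - digit a r (m + 1) % p
      + a (m + 1) * (digit a r m % p) := by
    intro m hm'
    have e₁ := Int.mul_ediv_add_emod ⌊bProd a (m + 1 + 1) * r⌋ p
    have e₀ := Int.mul_ediv_add_emod ⌊bProd a (m + 1) * r⌋ p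
    rw [hm (m + 1) (by omega)] at e₁
    rw [hm m hm'] at e₀
    have hz := digit_eq a r (m + 1)
    rw [digit_eq a (r / p), hF, hF]
    linear_combination e₁ - (a (m + 1) : ℤ) * e₀ - hz
  by_contra h
  obtain ⟨m, rfl⟩ : ∃ m, n = m + 1 := ⟨n - 1, by omega⟩
  have h' := notMem_thicken.1 h
  have hm1 : m ∉ jSet a r ∪ baseJumps a := fun hx => h'.2.2 m hx rfl
  have hm2 := h'.1
  simp only [mem_union, not_or, notMem_jSet, notMem_baseJumps] at hm1 hm2
  refine hn (mul_left_cancel₀ hpz ?_)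
  rw [hd m (by omega), hd (m + 1) (by omega), ← hm2.1, ← hm2.2, ← hm1.1]

/-! ### Smallness of thickenings -/

lemma thicken_eq (x : Set ℕ) :
    thicken x = x ∪ ({n | n + 1 ∈ x} ∪ {n | ∃ m ∈ x, n = m + 1}) := rfl

lemma thicken_mem {I : Set (Set ℕ)} (hid : IsIdeal I) (htr : TransInv I) {x : Set ℕ}
    (hx : x ∈ I) : thicken x ∈ I :=
  thicken_eq x ▸ hid.2.1 hx (hid.2.1 (htr x hx).2 (htr x hx).1)

lemma le_of_mem_thicken {x : Set ℕ} {N : ℕ} (hx : ∀ n ∈ x, N + 1 ≤ n) :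
    ∀ n ∈ thicken x, N ≤ n := by
  rintro n (hn | hn | ⟨m, hm, rfl⟩)
  · have := hx _ hn; omega
  · have := hx _ hn; omega
  · have := hx _ hm; omega

lemma mem_thicken_diff {x : Set ℕ} {n N : ℕ} (hn : n ∈ thicken x) (hN : N + 1 ≤ n) :
    n ∈ thicken (x \ {k | k < N}) := by
  rcases hn with hn | hn | ⟨m, hm, rfl⟩
  · exact Or.inl ⟨hn, fun h : n < N => by omega⟩
  · exact Or.inr (Or.inl ⟨hn, fun h : n + 1 < N => by omega⟩)
  · exact Or.inr (Or.inr ⟨m, ⟨hm, fun h : m < N => by omega⟩, rfl⟩)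

lemma mem_thicken_inter {x : Set ℕ} {n N : ℕ} (hn : n ∈ thicken x) (hN : n < N) :
    n ∈ thicken (x ∩ {k | k < N + 1}) := by
  rcases hn with hn | hn | ⟨m, hm, rfl⟩
  · exact Or.inl ⟨hn, (by omega : n < N + 1)⟩
  · exact Or.inr (Or.inl ⟨hn, (by omega : n + 1 < N + 1)⟩)
  · exact Or.inr (Or.inr ⟨m, ⟨hm, (by omega : m < N + 1)⟩, rfl⟩)

lemma IsLscSubmeasure.biUnion_range_le {φ : Set ℕ → ℝ≥0∞} (hφ : IsLscSubmeasure φ)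
    (x : ℕ → Set ℕ) (n : ℕ) :
    φ (⋃ i ∈ Finset.range n, x i) ≤ ∑ i ∈ Finset.range n, φ (x i) := by
  induction n with
  | zero => simp [hφ.1]
  | succ n ih =>
    rw [Finset.sum_range_succ, Finset.range_add_one, Finset.set_biUnion_insert, union_comm]
    exact (hφ.2.2.1 _ _).trans (add_le_add_left ih _)

lemma IsLscSubmeasure.iUnion_le {φ : Set ℕ → ℝ≥0∞} (hφ : IsLscSubmeasure φ) {x : ℕ → Set ℕ}
    (hx : ∀ i, ∀ k ∈ x i, i ≤ k) : φ (⋃ i, x i) ≤ ∑' i, φ (x i) := by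
  rw [hφ.2.2.2.2]
  refine iSup_le fun n => ?_
  refine (hφ.2.1 ?_).trans ((hφ.biUnion_range_le x n).trans (ENNReal.sum_le_tsum _))
  rintro k ⟨hk, hkn⟩
  obtain ⟨i, hi⟩ := mem_iUnion.1 hk
  have h : k < n := hkn
  exact mem_iUnion₂.2 ⟨i, Finset.mem_range.2 ((hx i k hi).trans_lt h), hi⟩

lemma IsLscSubmeasure.inter_lt_top {φ : Set ℕ → ℝ≥0∞} (hφ : IsLscSubmeasure φ) (x : Set ℕ)
    (n : ℕ) : φ (x ∩ {k | k < n}) < ⊤ := by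
  induction n with
  | zero => simp [hφ.1]
  | succ n ih =>
    refine (hφ.2.1 (y := (x ∩ {k | k < n}) ∪ {n}) ?_).trans_lt
      ((hφ.2.2.1 _ _).trans_lt (ENNReal.add_lt_top.2 ⟨ih, (hφ.2.2.2.1 n).2⟩))
    rintro k ⟨hk, hkn⟩
    have h : k < n + 1 := hkn
    rcases Nat.lt_succ_iff_lt_or_eq.1 h with h | h
    · exact Or.inl ⟨hk, h⟩
    · exact Or.inr h

lemma IsLscSubmeasure.lt_top_of_mem_exh {φ : Set ℕ → ℝ≥0∞} (hφ : IsLscSubmeasure φ) {x : Set ℕ}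
    (hx : x ∈ Exh φ) : φ x < ⊤ := by
  obtain ⟨n, hn⟩ := (ENNReal.tendsto_nhds_zero.1 hx 1 one_pos).exists
  have h := hφ.2.2.1 (x ∩ {k | k < n}) (x \ {k | k < n})
  rw [inter_union_sdiff] at h
  exact h.trans_lt (ENNReal.add_lt_top.2 ⟨hφ.inter_lt_top x n, hn.trans_lt ENNReal.one_lt_top⟩)

/-- Thickening is uniformly continuous at the empty set, on sets far to the right. -/
lemma IsLscSubmeasure.thicken_small {φ : Set ℕ → ℝ≥0∞} (hφ : IsLscSubmeasure φ)
    (hid : IsIdeal (Exh φ)) (htr : TransInv (Exh φ)) {ε : ℝ≥0∞} (hε : 0 < ε) :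
    ∃ δ > 0, ∃ N : ℕ, ∀ x : Set ℕ, (∀ n ∈ x, N ≤ n) → φ x < δ → φ (thicken x) ≤ ε := by
  by_contra! hcon
  have hex : ∀ N : ℕ, ∃ x : Set ℕ, (∀ n ∈ x, N ≤ n) ∧ φ x ≤ 2⁻¹ ^ N ∧ ε < φ (thicken x) ∧
      ∃ m, ∀ k ∈ x, k < m := by
    intro N
    obtain ⟨x, hxN, hx, hxε⟩ := hcon (2⁻¹ ^ N) (ENNReal.pow_pos (by simp) N) N
    rw [hφ.2.2.2.2 (thicken x), lt_iSup_iff] at hxε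
    obtain ⟨m, hm⟩ := hxε
    exact ⟨x ∩ {k | k < m + 1}, fun n hn => hxN n hn.1,
      (hφ.2.1 inter_subset_left).trans hx.le,
      hm.trans_le (hφ.2.1 fun n hn => mem_thicken_inter hn.1 hn.2), m + 1, fun k hk => hk.2⟩
  choose f hfN hf hfε b hb using hex
  have hX : (⋃ i, f i) ∈ Exh φ := by
    refine ENNReal.tendsto_nhds_zero.2 fun η hη => ?_
    have hsum : ∑' i : ℕ, (2⁻¹ : ℝ≥0∞) ^ i ≠ ⊤ := by
      rw [ENNReal.tsum_geometric, ENNReal.one_sub_inv_two, inv_inv]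
      exact ENNReal.ofNat_ne_top
    obtain ⟨K, hK⟩ := (ENNReal.tendsto_nhds_zero.1
      (ENNReal.tendsto_sum_nat_add (fun i => (2⁻¹ : ℝ≥0∞) ^ i) hsum) η hη).exists
    have hbK : ∀ᶠ n in atTop, ∀ i ∈ Finset.range K, b i ≤ n :=
      (Finset.eventually_all _).2 fun i _ => eventually_ge_atTop _
    filter_upwards [hbK] with n hn
    refine (hφ.2.1 (y := ⋃ i, f (i + K)) ?_).trans ((hφ.iUnion_le fun i k hk =>
      (Nat.le_add_right i K).trans (hfN _ k hk)).trans ((ENNReal.tsum_le_tsum fun i =>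
        hf (i + K)).trans hK))
    rintro k ⟨hk, hkn⟩
    obtain ⟨i, hi⟩ := mem_iUnion.1 hk
    have hkn' : ¬ k < n := hkn
    have hiK : K ≤ i := by
      by_contra! hlt
      have h1 := hn i (Finset.mem_range.2 hlt)
      have h2 := hb i k hi
      omega
    exact mem_iUnion.2 ⟨i - K, by rwa [Nat.sub_add_cancel hiK]⟩
  obtain ⟨n, hn⟩ := (ENNReal.tendsto_nhds_zero.1 (thicken_mem hid htr hX) ε hε).exists
  refine (hfε (n + 1)).not_ge (le_trans (hφ.2.1 fun k hk => ?_) hn)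
  refine ⟨thicken_mono (subset_iUnion f _) hk, fun h : k < n => ?_⟩
  have := le_of_mem_thicken (hfN (n + 1)) k hk
  omega

lemma IsLscSubmeasure.small_of_subset_thicken {φ : Set ℕ → ℝ≥0∞} (hφ : IsLscSubmeasure φ)
    (hid : IsIdeal (Exh φ)) (htr : TransInv (Exh φ)) {b : Set ℕ} (hb : b ∈ Exh φ) {ε : ℝ}
    (hε : 0 < ε) :
    ∃ δ : ℝ, 0 < δ ∧ ∃ N : ℕ, ∀ x z : Set ℕ, φ x < ENNReal.ofReal δ → (∀ n ∈ z, N ≤ n) →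
      z ⊆ thicken (x ∪ b) → φ z ≤ ENNReal.ofReal ε := by
  obtain ⟨δ, hδ, N, h⟩ := hφ.thicken_small hid htr (ENNReal.ofReal_pos.2 hε)
  obtain ⟨η, hη, hηδ⟩ : ∃ η : ℝ, 0 < η ∧ ENNReal.ofReal η + ENNReal.ofReal η ≤ δ := by
    obtain ⟨c, hc, hcδ⟩ := ENNReal.lt_iff_exists_real_btwn.1 hδ
    have hc0 : 0 < c := ENNReal.ofReal_pos.1 hcδ.1
    refine ⟨c / 2, half_pos hc0, ?_⟩
    rw [← ENNReal.ofReal_add (by positivity) (by positivity), add_halves]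
    exact hcδ.2.le
  obtain ⟨M, hM, hNM⟩ := ((ENNReal.tendsto_nhds_zero.1 hb _ (ENNReal.ofReal_pos.2 hη)).and
    (eventually_ge_atTop N)).exists
  refine ⟨η, hη, M + 1, fun x z hx hz hzx => ?_⟩
  have hsub : z ⊆ thicken ((x ∪ b) \ {k | k < M}) :=
    fun n hn => mem_thicken_diff (hzx hn) (hz n hn)
  refine (hφ.2.1 hsub).trans (h _ (fun n hn => ?_) ?_)
  · have : ¬ n < M := hn.2
    omega
  · rw [union_sdiff_distrib]
    refine (hφ.2.2.1 _ _).trans_lt ((ENNReal.add_lt_add_of_lt_of_le ?_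
      ((hφ.2.1 sdiff_subset).trans_lt hx) hM).trans_le hηδ)
    exact (hM.trans_lt ENNReal.ofReal_lt_top).ne

/-! ### Metrization of a quasi-metric -/

lemma exists_pseudometric_uniformly_equiv {X : Type*} (H : Set X) (ρ : X → X → ℝ)
    (hnn : ∀ r s, 0 ≤ ρ r s) (hself : ∀ r, ρ r r = 0) (hsymm : ∀ r s, ρ r s = ρ s r)
    (htri : ∀ ε : ℝ, 0 < ε → ∃ δ : ℝ, 0 < δ ∧ ∀ r ∈ H, ∀ s ∈ H, ∀ t ∈ H,
      ρ r s < δ → ρ s t < δ → ρ r t < ε) :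
    ∃ d : X → X → ℝ, (∀ r s, 0 ≤ d r s) ∧ (∀ r, d r r = 0) ∧ (∀ r s, d r s = d s r) ∧
      (∀ r ∈ H, ∀ s ∈ H, ∀ t ∈ H, d r t ≤ d r s + d s t) ∧
      (∀ ε : ℝ, 0 < ε → ∃ δ : ℝ, 0 < δ ∧ ∀ r ∈ H, ∀ s ∈ H,
        (ρ r s < δ → d r s < ε) ∧ (d r s < δ → ρ r s < ε)) := by
  classical
  let f : H × H → ℝ := fun x => ρ x.1 x.2
  have hbasis : (comap f (nhds 0)).HasBasis (fun ε : ℝ => 0 < ε) fun ε => {x | f x < ε} := by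
    refine (Metric.nhds_basis_ball.comap f).congr (fun _ => Iff.rfl) fun ε _ => ?_
    ext x
    have : 0 ≤ f x := hnn _ _
    simp [abs_of_nonneg this]
  let U : UniformSpace H := UniformSpace.ofCore
    { uniformity := comap f (nhds 0)
      refl := by
        refine (hbasis.ge_iff).2 fun ε hε => ?_
        rintro ⟨x, y⟩ hxy
        obtain rfl : x = y := by simpa using hxy
        simpa [f, hself] using hε
      symm := by
        refine (hbasis.tendsto_iff hbasis).2 fun ε hε => ⟨ε, hε, fun x hx => ?_⟩
        have hx' : ρ x.1 x.2 < ε := hx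
        rw [hsymm] at hx'
        exact hx'
      comp := by
        refine (hbasis.ge_iff).2 fun ε hε => ?_
        obtain ⟨δ, hδ, h⟩ := htri ε hε
        refine mem_of_superset (mem_lift' (hbasis.mem_of_mem hδ)) ?_
        rintro ⟨x, z⟩ ⟨y, hxy, hyz⟩
        exact h x x.2 y y.2 z z.2 hxy hyz }
  have hU : uniformity H = comap f (nhds 0) := rfl
  have : (uniformity H).IsCountablyGenerated := by
    rw [hU]
    infer_instance
  let := UniformSpace.pseudoMetricSpace H
  have hd : (uniformity H).HasBasis (fun ε : ℝ => 0 < ε) fun ε => {x : H × H | dist x.1 x.2 < ε} :=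
    Metric.uniformity_basis_dist
  refine ⟨fun r s => if h : r ∈ H ∧ s ∈ H then dist (⟨r, h.1⟩ : H) ⟨s, h.2⟩ else 0,
    fun r s => ?_, fun r => ?_, fun r s => ?_, fun r hr s hs t ht => ?_, fun ε hε => ?_⟩
  · dsimp only
    split_ifs
    exacts [dist_nonneg, le_rfl]
  · simp
  · simp only [and_comm (a := r ∈ H), dist_comm]
  · simp only [hr, hs, ht, and_self, dite_true]
    exact dist_triangle _ _ _
  · obtain ⟨δ₁, hδ₁, h₁⟩ := hbasis.mem_iff.1 (hU ▸ hd.mem_of_mem hε)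
    obtain ⟨δ₂, hδ₂, h₂⟩ := hd.mem_iff.1 (hU.symm ▸ hbasis.mem_of_mem hε)
    refine ⟨min δ₁ δ₂, lt_min hδ₁ hδ₂, fun r hr s hs => ?_⟩
    simp only [hr, hs, and_self, dite_true]
    exact ⟨fun h => h₁ (show f (⟨r, hr⟩, ⟨s, hs⟩) < δ₁ from h.trans_le (min_le_left _ _)),
      fun h => show f (⟨r, hr⟩, ⟨s, hs⟩) < ε from
        h₂ (show dist (⟨r, hr⟩ : H) ⟨s, hs⟩ < δ₂ from h.trans_le (min_le_right _ _))⟩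

/-! ### The group of reals whose digit jumps lie in the ideal -/

/-- A base sequence adapted to the translation invariant exhaustive ideal of a submeasure. -/
structure AdaptedPair (a : ℕ → ℕ) (φ : Set ℕ → ℝ≥0∞) : Prop where
  two_le : ∀ n, 2 ≤ a n
  lsc : IsLscSubmeasure φ
  ideal : IsIdeal (Exh φ)
  trans : TransInv (Exh φ)
  adapted : AdaptedTo a (Exh φ)

/-- The group norm whose associated distance is `rho`. -/
noncomputable def jumpNorm (a : ℕ → ℕ) (φ : Set ℕ → ℝ≥0∞) (t : ℝ) : ℝ :=
  (φ (jSet a |t|)).toReal + |t|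

lemma rho_eq (a : ℕ → ℕ) (φ : Set ℕ → ℝ≥0∞) (r s : ℝ) : rho a φ r s = jumpNorm a φ (r - s) := rfl

lemma jumpNorm_neg (a : ℕ → ℕ) (φ : Set ℕ → ℝ≥0∞) (t : ℝ) :
    jumpNorm a φ (-t) = jumpNorm a φ t := by
  rw [jumpNorm, abs_neg, jumpNorm]

lemma abs_le_jumpNorm (a : ℕ → ℕ) (φ : Set ℕ → ℝ≥0∞) (t : ℝ) : |t| ≤ jumpNorm a φ t :=
  le_add_of_nonneg_left ENNReal.toReal_nonneg

lemma jumpNorm_lt {a : ℕ → ℕ} {φ : Set ℕ → ℝ≥0∞} {t ε : ℝ} (hε : 0 < ε)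
    (h : φ (jSet a |t|) ≤ ENNReal.ofReal (ε / 2)) (ht : |t| < ε / 2) : jumpNorm a φ t < ε := by
  have := ENNReal.toReal_le_of_le_ofReal (half_pos hε).le h
  rw [jumpNorm]
  linarith

lemma neg_mem_Hset {a : ℕ → ℕ} {I : Set (Set ℕ)} {r : ℝ} (hr : r ∈ Hset a I) :
    -r ∈ Hset a I := by
  have h : jSet a |r| ∈ I := hr
  rw [← abs_neg] at h
  exact h

namespace AdaptedPair

lemma phi_lt {a : ℕ → ℕ} {φ : Set ℕ → ℝ≥0∞} (h : AdaptedPair a φ) {t δ : ℝ}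
    (ht : t ∈ Hset a (Exh φ)) (hδ : jumpNorm a φ t < δ) : φ (jSet a |t|) < ENNReal.ofReal δ := by
  rw [ENNReal.lt_ofReal_iff_toReal_lt (h.lsc.lt_top_of_mem_exh ht).ne]
  exact (le_add_of_nonneg_right (abs_nonneg t)).trans_lt hδ

lemma mem_of_subset_thicken {a : ℕ → ℕ} {φ : Set ℕ → ℝ≥0∞} (h : AdaptedPair a φ) {x z : Set ℕ}
    (hx : x ∈ Exh φ) (hz : z ⊆ thicken (x ∪ baseJumps a)) : z ∈ Exh φ :=
  h.ideal.1 (thicken_mem h.ideal h.trans (h.ideal.2.1 hx h.adapted)) hz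

lemma small {a : ℕ → ℕ} {φ : Set ℕ → ℝ≥0∞} (h : AdaptedPair a φ) {ε : ℝ} (hε : 0 < ε) :
    ∃ δ : ℝ, 0 < δ ∧ ∃ N : ℕ, ∀ x z : Set ℕ, φ x < ENNReal.ofReal δ → (∀ n ∈ z, N ≤ n) →
      z ⊆ thicken (x ∪ baseJumps a) → φ z ≤ ENNReal.ofReal ε :=
  h.lsc.small_of_subset_thicken h.ideal h.trans h.adapted hε

lemma phi_union_lt {a : ℕ → ℕ} {φ : Set ℕ → ℝ≥0∞} (h : AdaptedPair a φ) {x y : Set ℕ} {δ : ℝ}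
    (hδ : 0 < δ) (hx : φ x < ENNReal.ofReal (δ / 2)) (hy : φ y < ENNReal.ofReal (δ / 2)) :
    φ (x ∪ y) < ENNReal.ofReal δ := by
  rw [← add_halves δ, ENNReal.ofReal_add (half_pos hδ).le (half_pos hδ).le]
  exact (h.lsc.2.2.1 x y).trans_lt (ENNReal.add_lt_add hx hy)

lemma zero_mem {a : ℕ → ℕ} {φ : Set ℕ → ℝ≥0∞} (h : AdaptedPair a φ) :
    (0 : ℝ) ∈ Hset a (Exh φ) := by
  have : jSet a |(0 : ℝ)| ∈ Exh φ := by
    rw [abs_zero, jSet_zero]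
    exact h.ideal.1 (h.ideal.2.2 0) (empty_subset _)
  exact this

lemma jumpNorm_zero {a : ℕ → ℕ} {φ : Set ℕ → ℝ≥0∞} (h : AdaptedPair a φ) :
    jumpNorm a φ 0 = 0 := by
  simp [jumpNorm, jSet_zero, h.lsc.1]

lemma add_mem {a : ℕ → ℕ} {φ : Set ℕ → ℝ≥0∞} (h : AdaptedPair a φ) {r s : ℝ}
    (hr : r ∈ Hset a (Exh φ)) (hs : s ∈ Hset a (Exh φ)) : r + s ∈ Hset a (Exh φ) :=
  h.mem_of_subset_thicken (h.ideal.2.1 hr hs) (jSet_abs_add_subset h.two_le r s)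

lemma sub_mem {a : ℕ → ℕ} {φ : Set ℕ → ℝ≥0∞} (h : AdaptedPair a φ) {r s : ℝ}
    (hr : r ∈ Hset a (Exh φ)) (hs : s ∈ Hset a (Exh φ)) : r - s ∈ Hset a (Exh φ) :=
  sub_eq_add_neg r s ▸ h.add_mem hr (neg_mem_Hset hs)

lemma jumpNorm_add {a : ℕ → ℕ} {φ : Set ℕ → ℝ≥0∞} (h : AdaptedPair a φ) {ε : ℝ} (hε : 0 < ε) :
    ∃ δ : ℝ, 0 < δ ∧ ∀ r ∈ Hset a (Exh φ), ∀ s ∈ Hset a (Exh φ),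
      jumpNorm a φ r < δ → jumpNorm a φ s < δ → jumpNorm a φ (r + s) < ε := by
  obtain ⟨δ, hδ, N, hN⟩ := h.small (half_pos hε)
  obtain ⟨η, hη, hηN⟩ := jSet_of_small h.two_le N
  refine ⟨min (δ / 2) (min (η / 2) (ε / 4)), by positivity, fun r hr s hs hrδ hsδ => ?_⟩
  simp only [lt_min_iff] at hrδ hsδ
  have habs := abs_add_le r s
  have hr' := abs_le_jumpNorm a φ r
  have hs' := abs_le_jumpNorm a φ s
  exact jumpNorm_lt hε (hN _ _ (h.phi_union_lt hδ (h.phi_lt hr hrδ.1) (h.phi_lt hs hsδ.1))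
    (hηN _ (abs_nonneg _) (by linarith)) (jSet_abs_add_subset h.two_le r s)) (by linarith)

end AdaptedPair

/-- Multiplication by `q` preserves `Hset` and is continuous at zero. -/
def IsContScalar (a : ℕ → ℕ) (φ : Set ℕ → ℝ≥0∞) (q : ℝ) : Prop :=
  (∀ r ∈ Hset a (Exh φ), q * r ∈ Hset a (Exh φ)) ∧
  ∀ ε : ℝ, 0 < ε → ∃ δ : ℝ, 0 < δ ∧ ∀ r ∈ Hset a (Exh φ),
    jumpNorm a φ r < δ → jumpNorm a φ (q * r) < ε

lemma IsContScalar.mul {a : ℕ → ℕ} {φ : Set ℕ → ℝ≥0∞} {p q : ℝ} (hp : IsContScalar a φ p)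
    (hq : IsContScalar a φ q) : IsContScalar a φ (p * q) := by
  refine ⟨fun r hr => mul_assoc p q r ▸ hp.1 _ (hq.1 r hr), fun ε hε => ?_⟩
  obtain ⟨δ, hδ, h⟩ := hp.2 ε hε
  obtain ⟨η, hη, h'⟩ := hq.2 δ hδ
  exact ⟨η, hη, fun r hr hrη => mul_assoc p q r ▸ h _ (hq.1 r hr) (h' r hr hrη)⟩

lemma IsContScalar.neg {a : ℕ → ℕ} {φ : Set ℕ → ℝ≥0∞} {q : ℝ} (hq : IsContScalar a φ q) :
    IsContScalar a φ (-q) := by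
  refine ⟨fun r hr => neg_mul q r ▸ neg_mem_Hset (hq.1 r hr), fun ε hε => ?_⟩
  obtain ⟨δ, hδ, h⟩ := hq.2 ε hε
  refine ⟨δ, hδ, fun r hr hrδ => ?_⟩
  rw [neg_mul, jumpNorm_neg]
  exact h r hr hrδ

namespace AdaptedPair

lemma isContScalar_one {a : ℕ → ℕ} {φ : Set ℕ → ℝ≥0∞} : IsContScalar a φ 1 :=
  ⟨fun r hr => (one_mul r).symm ▸ hr, fun ε hε => ⟨ε, hε, fun r _ h => (one_mul r).symm ▸ h⟩⟩

lemma isContScalar_natCast {a : ℕ → ℕ} {φ : Set ℕ → ℝ≥0∞} (h : AdaptedPair a φ) (n : ℕ) :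
    IsContScalar a φ n := by
  induction n with
  | zero =>
    refine ⟨fun r _ => ?_, fun ε hε => ⟨1, one_pos, fun r _ _ => ?_⟩⟩
    · simpa using h.zero_mem
    · simpa [h.jumpNorm_zero] using hε
  | succ n ih =>
    have e : ∀ r : ℝ, ((n + 1 : ℕ) : ℝ) * r = n * r + r := fun r => by push_cast; ring
    refine ⟨fun r hr => e r ▸ h.add_mem (ih.1 r hr) hr, fun ε hε => ?_⟩
    obtain ⟨δ, hδ, hadd⟩ := h.jumpNorm_add hε
    obtain ⟨η, hη, hn⟩ := ih.2 δ hδ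
    refine ⟨min η δ, lt_min hη hδ, fun r hr hrδ => e r ▸ hadd _ (ih.1 r hr) r hr ?_ ?_⟩
    · exact hn r hr (hrδ.trans_le (min_le_left _ _))
    · exact hrδ.trans_le (min_le_right _ _)

lemma isContScalar_intCast {a : ℕ → ℕ} {φ : Set ℕ → ℝ≥0∞} (h : AdaptedPair a φ) (k : ℤ) :
    IsContScalar a φ k := by
  obtain ⟨n, rfl | rfl⟩ := k.eq_nat_or_neg
  · simpa using h.isContScalar_natCast n
  · simpa using (h.isContScalar_natCast n).neg

lemma isContScalar_inv_prime {a : ℕ → ℕ} {φ : Set ℕ → ℝ≥0∞} (h : AdaptedPair a φ) {p : ℕ}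
    (hp : p ∈ prSet a) : IsContScalar a φ (p : ℝ)⁻¹ := by
  obtain ⟨hprime, hev⟩ := hp
  obtain ⟨M, hM⟩ := eventually_atTop.1 hev
  have hp1 : (1 : ℝ) ≤ p := by exact_mod_cast hprime.one_le
  have habs : ∀ r : ℝ, |(p : ℝ)⁻¹ * r| = |r| / p := fun r => by
    rw [abs_mul, abs_of_pos (by positivity), inv_mul_eq_div]
  have hle : ∀ r : ℝ, |r| / p ≤ |r| := fun r => div_le_self (abs_nonneg r) hp1
  refine ⟨fun r hr => ?_, fun ε hε => ?_⟩
  · suffices hsuff : jSet a (|r| / p) ∈ Exh φ by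
      rw [← habs] at hsuff
      exact hsuff
    have hfin : ∀ N : ℕ, {k | k < N} ∈ Exh φ := fun N =>
      tendsto_atTop_of_eventually_const (i₀ := N) fun n hn => by
        have he : {k | k < N} \ {k | k < n} = (∅ : Set ℕ) :=
          sdiff_eq_empty.2 fun k (hk : k < N) => hk.trans_le hn
        rw [he, h.lsc.1]
    refine h.ideal.1 (h.ideal.2.1 (hfin (M + 1)) (h.mem_of_subset_thicken hr Subset.rfl))
      fun n hn => ?_
    rcases lt_or_ge n (M + 1) with hlt | hge
    · exact Or.inl hlt
    · exact Or.inr (jSet_div_subset hprime.pos hM _ hn hge)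
  · obtain ⟨δ, hδ, N, hN⟩ := h.small (half_pos hε)
    obtain ⟨η, hη, hηN⟩ := jSet_of_small h.two_le (max N (M + 1))
    refine ⟨min δ (min η (ε / 2)), by positivity, fun r hr hrδ => ?_⟩
    simp only [lt_min_iff] at hrδ
    have hr' := abs_le_jumpNorm a φ r
    have hr'' := hle r
    have hJ := hηN (|r| / p) (by positivity) (by linarith)
    refine jumpNorm_lt hε ?_ (by rw [habs]; linarith)
    rw [habs]
    exact hN _ _ (h.phi_lt hr hrδ.1) (fun n hn => (le_max_left _ _).trans (hJ n hn))
      fun n hn => jSet_div_subset hprime.pos hM _ hn ((le_max_right _ _).trans (hJ n hn))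

lemma isContScalar_inv {a : ℕ → ℕ} {φ : Set ℕ → ℝ≥0∞} (h : AdaptedPair a φ) (l : ℕ)
    (hl : 0 < l) (hpr : ∀ p : ℕ, p.Prime → p ∣ l → p ∈ prSet a) : IsContScalar a φ (l : ℝ)⁻¹ := by
  induction l using induction_on_primes with
  | zero => exact absurd hl (lt_irrefl 0)
  | one => simpa using isContScalar_one
  | prime_mul p m hp ih =>
    push_cast
    rw [mul_inv]
    exact (h.isContScalar_inv_prime (hpr p hp (dvd_mul_right p m))).mul
      (ih (Nat.pos_of_mul_pos_left hl) fun q hq hqm => hpr q hq (hqm.mul_left p))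

lemma isContScalar {a : ℕ → ℕ} {φ : Set ℕ → ℝ≥0∞} (h : AdaptedPair a φ) {q : ℝ}
    (hq : q ∈ Qa a) : IsContScalar a φ q := by
  obtain ⟨k, l, hl, hpr, rfl⟩ := hq
  exact div_eq_mul_inv (k : ℝ) l ▸ (h.isContScalar_intCast k).mul (h.isContScalar_inv l hl hpr)

lemma exists_limit {a : ℕ → ℕ} {φ : Set ℕ → ℝ≥0∞} (h : AdaptedPair a φ) {u : ℕ → ℝ}
    (hu : ∀ n, u n ∈ Hset a (Exh φ))
    (hc : ∀ ε : ℝ, 0 < ε → ∃ N : ℕ, ∀ m ≥ N, ∀ n ≥ N, rho a φ (u m) (u n) < ε) :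
    ∃ r ∈ Hset a (Exh φ), ∀ ε : ℝ, 0 < ε → ∃ N : ℕ, ∀ n ≥ N, rho a φ (u n) r < ε := by
  have hcau : CauchySeq u := Metric.cauchySeq_iff.2 fun ε hε => by
    obtain ⟨N, hN⟩ := hc ε hε
    exact ⟨N, fun m hm n hn => (abs_le_jumpNorm a φ _).trans_lt (hN m hm n hn)⟩
  obtain ⟨r, hr⟩ := cauchySeq_tendsto_of_complete hcau
  have hlim : ∀ ε : ℝ, 0 < ε → ∃ N : ℕ, ∀ n ≥ N,
      φ (jSet a |u n - r|) ≤ ENNReal.ofReal ε ∧ |u n - r| < ε := by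
    intro ε hε
    obtain ⟨δ, hδ, N, hN⟩ := h.small hε
    obtain ⟨η, hη, hηN⟩ := jSet_of_small h.two_le N
    obtain ⟨M, hM⟩ := hc δ hδ
    obtain ⟨L, hL⟩ := Metric.tendsto_atTop.1 hr (min η ε) (lt_min hη hε)
    refine ⟨max M L, fun n hn => ?_⟩
    have hnL : |u n - r| < min η ε := hL n ((le_max_right _ _).trans hn)
    refine ⟨?_, hnL.trans_le (min_le_right _ _)⟩
    rw [h.lsc.2.2.2.2]
    refine iSup_le fun K => ?_
    obtain ⟨m, hsub, hmM⟩ := ((eventually_jSet_inter_subset h.two_le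
      ((hr.const_sub (u n)).abs) K).and (eventually_ge_atTop M)).exists
    exact hN _ _ (h.phi_lt (h.sub_mem (hu n) (hu m)) (hM n ((le_max_left _ _).trans hn) m hmM))
      (fun k hk => hηN _ (abs_nonneg _) (hnL.trans_le (min_le_left _ _)) k hk.1) hsub
  refine ⟨r, ?_, fun ε hε => ?_⟩
  · refine ENNReal.tendsto_nhds_zero.2 fun ε hε => ?_
    obtain ⟨c, hc0, hcε⟩ := ENNReal.lt_iff_exists_real_btwn.1 hε
    have hcpos : 0 < c := ENNReal.ofReal_pos.1 hcε.1
    obtain ⟨δ, hδ, N, hN⟩ := h.small hcpos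
    obtain ⟨M, hM⟩ := hlim (δ / 4) (by positivity)
    have hlt : ENNReal.ofReal (δ / 4) < ENNReal.ofReal (δ / 2) :=
      (ENNReal.ofReal_lt_ofReal_iff (by positivity)).2 (by linarith)
    obtain ⟨k, hk⟩ := (ENNReal.tendsto_nhds_zero.1 (hu M) _
      (ENNReal.ofReal_pos.2 (by positivity : 0 < δ / 4))).exists
    filter_upwards [eventually_ge_atTop (max N (k + 1))] with n hn
    have hsub := jSet_abs_sub_subset h.two_le (u M) (u M - r)
    rw [sub_sub_cancel] at hsub
    refine (hN ((jSet a |u M| \ {i | i < k}) ∪ jSet a |u M - r|) _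
      (h.phi_union_lt hδ (hk.trans_lt hlt) ((hM M le_rfl).1.trans_lt hlt)) ?_ ?_).trans hcε.2.le
    · intro i hi
      have : ¬ i < n := hi.2
      have := le_max_left N (k + 1)
      omega
    · intro i hi
      have : ¬ i < n := hi.2
      have := le_max_right N (k + 1)
      refine thicken_mono ?_ (mem_thicken_diff (N := k) (hsub hi.1) (by omega))
      rintro j ⟨(hj | hj) | hj, hjk⟩
      · exact Or.inl (Or.inl ⟨hj, hjk⟩)
      · exact Or.inl (Or.inr hj)
      · exact Or.inr hj
  · obtain ⟨N, hN⟩ := hlim (ε / 2) (half_pos hε)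
    exact ⟨N, fun n hn => jumpNorm_lt hε (hN n hn).1 (hN n hn).2⟩

lemma exists_countable_partition {a : ℕ → ℕ} {φ : Set ℕ → ℝ≥0∞} (h : AdaptedPair a φ) {ε : ℝ}
    (hε : 0 < ε) :
    ∃ c : ℝ → ℕ × ℤ, ∀ r ∈ Hset a (Exh φ), ∀ s ∈ Hset a (Exh φ), c r = c s → rho a φ r s < ε := by
  obtain ⟨δ, hδ, N, hN⟩ := h.small (half_pos hε)
  have hM : ∀ r : ℝ, ∃ M, r ∈ Hset a (Exh φ) →
      N ≤ M ∧ φ (jSet a |r| \ {k | k < M}) < ENNReal.ofReal (δ / 2) := by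
    intro r
    by_cases hr : r ∈ Hset a (Exh φ)
    · have ht : Tendsto (fun n => φ (jSet a |r| \ {k | k < n})) atTop (nhds 0) := hr
      obtain ⟨M, hM⟩ := ((eventually_ge_atTop N).and
        (ht.eventually (Iio_mem_nhds (ENNReal.ofReal_pos.2 (half_pos hδ))))).exists
      exact ⟨M, fun _ => hM⟩
    · exact ⟨0, fun hr' => absurd hr' hr⟩
  choose M hM using hM
  choose η hη hηN using fun m : ℕ => jSet_of_small h.two_le (m + 1)
  have hκ : ∀ m, 0 < min (η m) (ε / 2) := fun m => lt_min (hη m) (half_pos hε)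
  refine ⟨fun r => (M r, ⌊r / min (η (M r)) (ε / 2)⌋), fun r hr s hs hrs => ?_⟩
  obtain ⟨hMrs, hfl⟩ := Prod.ext_iff.1 hrs
  dsimp only at hMrs hfl
  rw [← hMrs] at hfl
  have hs' := hM s hs
  rw [← hMrs] at hs'
  have hr' := hM r hr
  have habs : |r - s| < min (η (M r)) (ε / 2) := by
    have := Int.abs_sub_lt_one_of_floor_eq_floor hfl
    rwa [← sub_div, abs_div, abs_of_pos (hκ _), div_lt_one (hκ _)] at this
  have hJ := hηN (M r) _ (abs_nonneg _) (habs.trans_le (min_le_left _ _))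
  refine jumpNorm_lt hε (hN _ _ (h.phi_union_lt hδ hr'.2 hs'.2) (fun n hn => ?_) fun n hn => ?_)
    (habs.trans_le (min_le_right _ _))
  · have := hJ n hn
    omega
  · refine thicken_mono ?_
      (mem_thicken_diff (jSet_abs_sub_subset h.two_le r s hn) (hJ n hn))
    rintro j ⟨(hj | hj) | hj, hjk⟩
    · exact Or.inl (Or.inl ⟨hj, hjk⟩)
    · exact Or.inl (Or.inr ⟨hj, hjk⟩)
    · exact Or.inr hj

lemma exists_countable_dense {a : ℕ → ℕ} {φ : Set ℕ → ℝ≥0∞} (h : AdaptedPair a φ) :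
    ∃ D : Set ℝ, D.Countable ∧ D ⊆ Hset a (Exh φ) ∧
      ∀ r ∈ Hset a (Exh φ), ∀ ε : ℝ, 0 < ε → ∃ s ∈ D, rho a φ r s < ε := by
  choose c hc using fun k : ℕ => h.exists_countable_partition (Nat.one_div_pos_of_nat (n := k))
  choose D hD hbij using fun k => exists_subset_bijOn (Hset a (Exh φ)) (c k)
  refine ⟨⋃ k, D k, countable_iUnion fun k =>
    countable_of_injective_of_countable_image (hbij k).injOn (to_countable _),
    iUnion_subset hD, fun r hr ε hε => ?_⟩
  obtain ⟨k, hk⟩ := exists_nat_one_div_lt hε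
  obtain ⟨s, hs, hsr⟩ := (hbij k).surjOn (mem_image_of_mem (c k) hr)
  exact ⟨s, mem_iUnion.2 ⟨k, hs⟩, (hc k r hr s (hD k hs) hsr.symm).trans hk⟩

end AdaptedPair

/-- Theorem 2.10: `I[a]` is a Polish `ℚ_a`-module. The submeasure
topology on `H` is given by a metric `d` uniformly equivalent to `ρ`, for which `H`
is complete and separable, the topology refines the one from ℝ, and the module
operations are continuous. -/
theorem Polish_module (a : ℕ → ℕ) (ha : ∀ n, 2 ≤ a n)
    (φ : Set ℕ → ℝ≥0∞) (hφ : IsLscSubmeasure φ)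
    (hid : IsIdeal (Exh φ)) (htr : TransInv (Exh φ)) (had : AdaptedTo a (Exh φ)) :
    -- `H` is a subgroup of ℝ closed under multiplication by elements of `ℚ_a`
    ((0 : ℝ) ∈ Hset a (Exh φ)) ∧
    (∀ r ∈ Hset a (Exh φ), ∀ s ∈ Hset a (Exh φ), r + s ∈ Hset a (Exh φ)) ∧
    (∀ r ∈ Hset a (Exh φ), -r ∈ Hset a (Exh φ)) ∧
    (∀ q ∈ Qa a, ∀ r ∈ Hset a (Exh φ), q * r ∈ Hset a (Exh φ)) ∧
    ∃ d : ℝ → ℝ → ℝ,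
      -- `d` is a metric on `H`
      (∀ r ∈ Hset a (Exh φ), ∀ s ∈ Hset a (Exh φ), 0 ≤ d r s) ∧
      (∀ r ∈ Hset a (Exh φ), ∀ s ∈ Hset a (Exh φ), (d r s = 0 ↔ r = s)) ∧
      (∀ r ∈ Hset a (Exh φ), ∀ s ∈ Hset a (Exh φ), d r s = d s r) ∧
      (∀ r ∈ Hset a (Exh φ), ∀ s ∈ Hset a (Exh φ), ∀ t ∈ Hset a (Exh φ),
        d r t ≤ d r s + d s t) ∧
      -- (1) uniform equivalence of `d` and `ρ`
      (∀ ε : ℝ, 0 < ε → ∃ δ : ℝ, 0 < δ ∧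
        ∀ r ∈ Hset a (Exh φ), ∀ s ∈ Hset a (Exh φ),
          (rho a φ r s < δ → d r s < ε) ∧ (d r s < δ → rho a φ r s < ε)) ∧
      -- (2) completeness
      (∀ u : ℕ → ℝ, (∀ n, u n ∈ Hset a (Exh φ)) →
        (∀ ε : ℝ, 0 < ε → ∃ N : ℕ, ∀ m ≥ N, ∀ n ≥ N, d (u m) (u n) < ε) →
        ∃ r ∈ Hset a (Exh φ),
          Filter.Tendsto (fun n => d (u n) r) Filter.atTop (nhds 0)) ∧
      -- (2) separability
      (∃ D : Set ℝ, D.Countable ∧ D ⊆ Hset a (Exh φ) ∧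
        ∀ r ∈ Hset a (Exh φ), ∀ ε : ℝ, 0 < ε → ∃ s ∈ D, d r s < ε) ∧
      -- (3) the `d`-topology refines the topology inherited from ℝ
      (∀ r ∈ Hset a (Exh φ), ∀ ε : ℝ, 0 < ε → ∃ δ : ℝ, 0 < δ ∧
        ∀ s ∈ Hset a (Exh φ), d r s < δ → |r - s| < ε) ∧
      -- (4) addition is continuous
      (∀ r ∈ Hset a (Exh φ), ∀ s ∈ Hset a (Exh φ), ∀ ε : ℝ, 0 < ε →
        ∃ δ : ℝ, 0 < δ ∧ ∀ r' ∈ Hset a (Exh φ), ∀ s' ∈ Hset a (Exh φ),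
          d r r' < δ → d s s' < δ → d (r + s) (r' + s') < ε) ∧
      -- (4) negation is continuous
      (∀ r ∈ Hset a (Exh φ), ∀ ε : ℝ, 0 < ε → ∃ δ : ℝ, 0 < δ ∧
        ∀ s ∈ Hset a (Exh φ), d r s < δ → d (-r) (-s) < ε) ∧
      -- (5) scalar multiplication by each `q ∈ ℚ_a` is continuous
      (∀ q ∈ Qa a, ∀ r ∈ Hset a (Exh φ), ∀ ε : ℝ, 0 < ε → ∃ δ : ℝ, 0 < δ ∧
        ∀ s ∈ Hset a (Exh φ), d r s < δ → d (q * r) (q * s) < ε) := by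
  have h : AdaptedPair a φ := ⟨ha, hφ, hid, htr, had⟩
  have hsymm : ∀ r s, rho a φ r s = rho a φ s r := fun r s => by
    rw [rho_eq, rho_eq, ← jumpNorm_neg, neg_sub]
  obtain ⟨d, hnn, hself, hdsymm, htri, hequiv⟩ :=
    exists_pseudometric_uniformly_equiv (Hset a (Exh φ)) (rho a φ)
      (fun r s => (abs_nonneg _).trans (abs_le_jumpNorm a φ _))
      (fun r => by rw [rho_eq, sub_self, h.jumpNorm_zero]) hsymm fun ε hε => by
        obtain ⟨δ, hδ, hadd⟩ := h.jumpNorm_add hε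
        refine ⟨δ, hδ, fun r hr s hs t ht hrs hst => ?_⟩
        have := hadd _ (h.sub_mem hr hs) _ (h.sub_mem hs ht) hrs hst
        rwa [sub_add_sub_cancel] at this
  have hrefine : ∀ ε : ℝ, 0 < ε → ∃ δ : ℝ, 0 < δ ∧ ∀ r ∈ Hset a (Exh φ), ∀ s ∈ Hset a (Exh φ),
      d r s < δ → |r - s| < ε := by
    intro ε hε
    obtain ⟨δ, hδ, hδε⟩ := hequiv ε hε
    exact ⟨δ, hδ, fun r hr s hs hrs =>
      (abs_le_jumpNorm a φ _).trans_lt ((hδε r hr s hs).2 hrs)⟩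
  have hscalar : ∀ q, IsContScalar a φ q → ∀ r ∈ Hset a (Exh φ), ∀ ε : ℝ, 0 < ε →
      ∃ δ : ℝ, 0 < δ ∧ ∀ s ∈ Hset a (Exh φ), d r s < δ → d (q * r) (q * s) < ε := by
    intro q hq r hr ε hε
    obtain ⟨δ₁, hδ₁, h₁⟩ := hequiv ε hε
    obtain ⟨δ₂, hδ₂, h₂⟩ := hq.2 δ₁ hδ₁
    obtain ⟨δ₃, hδ₃, h₃⟩ := hequiv δ₂ hδ₂
    refine ⟨δ₃, hδ₃, fun s hs hrs => (h₁ _ (hq.1 r hr) _ (hq.1 s hs)).1 ?_⟩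
    rw [rho_eq, ← mul_sub]
    exact h₂ _ (h.sub_mem hr hs) ((h₃ r hr s hs).2 hrs)
  refine ⟨h.zero_mem, fun r hr s hs => h.add_mem hr hs, fun r hr => neg_mem_Hset hr,
    fun q hq => (h.isContScalar hq).1, d, fun r _ s _ => hnn r s, fun r hr s hs => ?_,
    fun r _ s _ => hdsymm r s, htri, hequiv, fun u hu hcau => ?_, ?_, fun r hr ε hε => ?_,
    fun r hr s hs ε hε => ?_, fun r hr ε hε => ?_, fun q hq => hscalar q (h.isContScalar hq)⟩
  · refine ⟨fun hd => ?_, fun hrs => hrs ▸ hself r⟩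
    by_contra hne
    obtain ⟨δ, hδ, hlt⟩ := hrefine _ (abs_pos.2 (sub_ne_zero.2 hne))
    exact lt_irrefl _ (hlt r hr s hs (hd ▸ hδ))
  · obtain ⟨r, hr, hlim⟩ := h.exists_limit hu fun ε hε => by
      obtain ⟨δ, hδ, hδε⟩ := hequiv ε hε
      obtain ⟨N, hN⟩ := hcau δ hδ
      exact ⟨N, fun m hm n hn => (hδε _ (hu m) _ (hu n)).2 (hN m hm n hn)⟩
    refine ⟨r, hr, Metric.tendsto_atTop.2 fun ε hε => ?_⟩
    obtain ⟨δ, hδ, hδε⟩ := hequiv ε hε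
    obtain ⟨N, hN⟩ := hlim δ hδ
    refine ⟨N, fun n hn => ?_⟩
    rw [Real.dist_0_eq_abs, abs_of_nonneg (hnn _ _)]
    exact (hδε _ (hu n) r hr).1 (hN n hn)
  · obtain ⟨D, hD, hDH, hdense⟩ := h.exists_countable_dense
    refine ⟨D, hD, hDH, fun r hr ε hε => ?_⟩
    obtain ⟨δ, hδ, hδε⟩ := hequiv ε hε
    obtain ⟨s, hs, hrs⟩ := hdense r hr δ hδ
    exact ⟨s, hs, (hδε r hr s (hDH hs)).1 hrs⟩
  · obtain ⟨δ, hδ, hlt⟩ := hrefine ε hε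
    exact ⟨δ, hδ, hlt r hr⟩
  · obtain ⟨δ₁, hδ₁, h₁⟩ := hequiv ε hε
    obtain ⟨δ₂, hδ₂, h₂⟩ := h.jumpNorm_add hδ₁
    obtain ⟨δ₃, hδ₃, h₃⟩ := hequiv δ₂ hδ₂
    refine ⟨δ₃, hδ₃, fun r' hr' s' hs' hrr hss =>
      (h₁ _ (h.add_mem hr hs) _ (h.add_mem hr' hs')).1 ?_⟩
    rw [rho_eq, add_sub_add_comm]
    exact h₂ _ (h.sub_mem hr hr') _ (h.sub_mem hs hs') ((h₃ r hr r' hr').2 hrr)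
      ((h₃ s hs s' hs').2 hss)
  · simpa using hscalar (-1) AdaptedPair.isContScalar_one.neg r hr ε hε
end
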